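/- arXiv:2311.04489 — 14 statements merged into one kernel-verified Lean document; each statement's English description precedes it below -/
import Mathlib

section
/- Let G be a finite group acting faithfully on a finite set Ω. If x and y are lengths of irredundant bases of G on Ω and z is a natural number with x ≤ z ≤ y, then G has an irredundant base of length z on Ω. Equivalently, I(G,Ω) is an interval of natural numbers, namely I(G,Ω) = {b(G,Ω), b(G,Ω)+1, …, B(G,Ω)} ∩ I(G,Ω) forms the set {min I(G,Ω), …, max I(G,Ω)}. -/
/-- `(ω 0, …, ω (ℓ-1))` is an *irredundant base* for the action of `G` on `Ω`:
the stabilizer chain `G ≥ G_{ω 0} ≥ G_{ω 0, ω 1} ≥ …` is strictly decreasing at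
every step and its final term is the trivial subgroup. -/
def IsIrrBase (G : Type*) [Group G] {Ω : Type*} [MulAction G Ω] {ℓ : ℕ}
    (ω : Fin ℓ → Ω) : Prop :=
  (∀ i : Fin ℓ, (⨅ j ∈ {j : Fin ℓ | j ≤ i}, MulAction.stabilizer G (ω j)) <
      ⨅ j ∈ {j : Fin ℓ | j < i}, MulAction.stabilizer G (ω j)) ∧
  (⨅ j, MulAction.stabilizer G (ω j)) = ⊥

/-- `𝓘(G,Ω)`: the set of lengths of irredundant bases of `G` on `Ω`. -/
def IrrBaseSizes (G : Type*) [Group G] (Ω : Type*) [MulAction G Ω] : Set ℕ :=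
  {ℓ | ∃ ω : Fin ℓ → Ω, IsIrrBase G ω}

/-- `I(G,Ω)`: the maximum length of an irredundant base of `G` on `Ω`. -/
noncomputable def maxIrrBaseSize (G : Type*) [Group G] (Ω : Type*) [MulAction G Ω] : ℕ :=
  sSup (IrrBaseSizes G Ω)

/-- There is a strictly decreasing chain of length `n` from `K` to `⊥`, each step being the meet
with some `s a`. -/
def ChainLen {L Ω : Type*} [CompleteLattice L] (s : Ω → L) : ℕ → L → Prop
  | 0, K => K = ⊥
  | n + 1, K => ∃ a, K ⊓ s a < K ∧ ChainLen s n (K ⊓ s a)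

theorem ChainLen.insert {L Ω : Type*} [CompleteLattice L] (s : Ω → L) (a : Ω) :
    ∀ (y : ℕ) (K : L), ChainLen s y K → K ⊓ s a < K →
      ∃ f, ChainLen s f (K ⊓ s a) ∧ ∀ z, f + 1 ≤ z → z ≤ y → ChainLen s z K := by
  intro y
  induction y with
  | zero =>
    intro K hK ha
    have hK' : K = ⊥ := hK
    subst hK'
    exact absurd ha not_lt_bot
  | succ y ih =>
    intro K hK ha
    obtain ⟨b, hb, hM⟩ := hK
    have hcomm : K ⊓ s a ⊓ s b = K ⊓ s b ⊓ s a := inf_right_comm _ _ _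
    by_cases h1 : K ⊓ s b ⊓ s a = K ⊓ s b
    · by_cases h2 : K ⊓ s a ⊓ s b = K ⊓ s a
      · have h3 : K ⊓ s a = K ⊓ s b := by rw [← h2, hcomm, h1]
        refine ⟨y, h3 ▸ hM, fun z hz1 hz2 => ?_⟩
        obtain rfl : z = y + 1 := by omega
        exact ⟨b, hb, hM⟩
      · refine ⟨y + 1, ⟨b, lt_of_le_of_ne inf_le_left h2, ?_⟩, fun z hz1 hz2 => by omega⟩
        rw [hcomm, h1]
        exact hM
    · obtain ⟨f, hf, hz⟩ := ih _ hM (lt_of_le_of_ne inf_le_left h1)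
      have step : ∀ z, f + 2 ≤ z → z ≤ y + 1 → ChainLen s z K := by
        intro z hz1 hz2
        obtain ⟨w, rfl⟩ : ∃ w, z = w + 1 := ⟨z - 1, by omega⟩
        exact ⟨b, hb, hz w (by omega) (by omega)⟩
      by_cases h2 : K ⊓ s a ⊓ s b = K ⊓ s a
      · have hf' : ChainLen s f (K ⊓ s a) := by rw [← h2, hcomm]; exact hf
        refine ⟨f, hf', fun z hz1 hz2 => ?_⟩
        rcases Nat.eq_or_lt_of_le hz1 with h | h
        · subst h
          exact ⟨a, ha, hf'⟩
        · exact step z h hz2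
      · exact ⟨f + 1, ⟨b, lt_of_le_of_ne inf_le_left h2, by rw [hcomm]; exact hf⟩, step⟩

theorem ChainLen.interval {L Ω : Type*} [CompleteLattice L] (s : Ω → L) :
    ∀ (x y z : ℕ) (K : L), ChainLen s x K → ChainLen s y K → x ≤ z → z ≤ y → ChainLen s z K := by
  intro x
  induction x with
  | zero =>
    intro y z K hx hy _ hzy
    have hK : K = ⊥ := hx
    subst hK
    cases y with
    | zero =>
      obtain rfl : z = 0 := by omega
      exact hx
    | succ y =>
      obtain ⟨a, ha, _⟩ := hy
      exact absurd ha not_lt_bot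
  | succ x ih =>
    intro y z K hx hy hxz hzy
    obtain ⟨a, ha, hxa⟩ := hx
    obtain ⟨f, hf, hz⟩ := ChainLen.insert s a y K hy ha
    by_cases h : f + 1 ≤ z
    · exact hz z h hzy
    · obtain ⟨w, rfl⟩ : ∃ w, z = w + 1 := ⟨z - 1, by omega⟩
      exact ⟨a, ha, ih f w _ hxa hf (by omega) (by omega)⟩

theorem iInf_fin_le_succ {L : Type*} [CompleteLattice L] {n : ℕ} (f : Fin (n + 1) → L)
    (i : Fin n) : (⨅ j ∈ {j : Fin (n + 1) | j ≤ i.succ}, f j) =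
      f 0 ⊓ ⨅ j ∈ {j : Fin n | j ≤ i}, f j.succ := by
  apply le_antisymm
  · refine le_inf (iInf₂_le (0 : Fin (n + 1)) (show (0 : Fin (n + 1)) ≤ i.succ from Fin.zero_le _)) (le_iInf₂ fun j hj => ?_)
    exact iInf₂_le j.succ (show j.succ ≤ i.succ from Fin.succ_le_succ_iff.2 (show j ≤ i from hj))
  · refine le_iInf₂ fun j hj => ?_
    induction j using Fin.cases with
    | zero => exact inf_le_left
    | succ j =>
      exact inf_le_right.trans
        (iInf₂_le j (show j ≤ i from Fin.succ_le_succ_iff.1 (show j.succ ≤ i.succ from hj)))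

theorem iInf_fin_lt_succ {L : Type*} [CompleteLattice L] {n : ℕ} (f : Fin (n + 1) → L)
    (i : Fin n) : (⨅ j ∈ {j : Fin (n + 1) | j < i.succ}, f j) =
      f 0 ⊓ ⨅ j ∈ {j : Fin n | j < i}, f j.succ := by
  apply le_antisymm
  · refine le_inf (iInf₂_le (0 : Fin (n + 1)) (show (0 : Fin (n + 1)) < i.succ from Fin.succ_pos _)) (le_iInf₂ fun j hj => ?_)
    exact iInf₂_le j.succ (show j.succ < i.succ from Fin.succ_lt_succ_iff.2 (show j < i from hj))
  · refine le_iInf₂ fun j hj => ?_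
    induction j using Fin.cases with
    | zero => exact inf_le_left
    | succ j =>
      exact inf_le_right.trans
        (iInf₂_le j (show j < i from Fin.succ_lt_succ_iff.1 (show j.succ < i.succ from hj)))

theorem iInf_fin_succ_aux {L : Type*} [CompleteLattice L] {n : ℕ} (f : Fin (n + 1) → L) :
    (⨅ j, f j) = f 0 ⊓ ⨅ j : Fin n, f j.succ := by
  apply le_antisymm
  · exact le_inf (iInf_le _ 0) (le_iInf fun j => iInf_le _ j.succ)
  · refine le_iInf fun j => ?_
    induction j using Fin.cases with
    | zero => exact inf_le_left
    | succ j => exact inf_le_right.trans (iInf_le _ j)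

theorem chainLen_iff {L Ω : Type*} [CompleteLattice L] (s : Ω → L) :
    ∀ (n : ℕ) (K : L), ChainLen s n K ↔ ∃ ω : Fin n → Ω,
      (∀ i : Fin n, (K ⊓ ⨅ j ∈ {j : Fin n | j ≤ i}, s (ω j)) <
        K ⊓ ⨅ j ∈ {j : Fin n | j < i}, s (ω j)) ∧ (K ⊓ ⨅ j, s (ω j)) = ⊥ := by
  intro n
  induction n with
  | zero =>
    intro K
    simp [ChainLen]
  | succ n ih =>
    intro K
    have h0 : ∀ ω : Fin (n + 1) → Ω,
        (⨅ j ∈ {j : Fin (n + 1) | j ≤ 0}, s (ω j)) = s (ω 0) := by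
      intro ω
      simp
    have h0' : ∀ ω : Fin (n + 1) → Ω,
        (⨅ j ∈ {j : Fin (n + 1) | j < 0}, s (ω j)) = ⊤ := by
      intro ω
      simp
    constructor
    · rintro ⟨a, ha, hC⟩
      obtain ⟨ω, h1, h2⟩ := (ih _).1 hC
      refine ⟨Fin.cons a ω, fun i => ?_, ?_⟩
      · induction i using Fin.cases with
        | zero =>
          rw [h0, h0', inf_top_eq]
          exact ha
        | succ i =>
          rw [iInf_fin_le_succ, iInf_fin_lt_succ, ← inf_assoc, ← inf_assoc]
          exact h1 i
      · rw [iInf_fin_succ_aux, ← inf_assoc]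
        exact h2
    · rintro ⟨ω, h1, h2⟩
      refine ⟨ω 0, ?_, (ih _).2 ⟨fun j => ω j.succ, fun i => ?_, ?_⟩⟩
      · have := h1 0
        rwa [h0, h0', inf_top_eq] at this
      · have := h1 i.succ
        rwa [iInf_fin_le_succ, iInf_fin_lt_succ, ← inf_assoc, ← inf_assoc] at this
      · rwa [iInf_fin_succ_aux, ← inf_assoc] at h2

theorem mem_irrBaseSizes_iff {G Ω : Type*} [Group G] [MulAction G Ω] (n : ℕ) :
    n ∈ IrrBaseSizes G Ω ↔ ChainLen (fun a : Ω => MulAction.stabilizer G a) n ⊤ := by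
  rw [chainLen_iff]
  simp only [top_inf_eq]
  rfl

/-- **Theorem 1 (Cameron).** For a finite group `G` acting faithfully on a finite
set `Ω`, the set `𝓘(G,Ω)` of lengths of irredundant bases is an interval of
natural numbers: if `x` and `y` are lengths of irredundant bases and
`x ≤ z ≤ y`, then `G` has an irredundant base of length `z`. -/
theorem irrBaseSizes_is_interval {G Ω : Type*} [Group G] [Finite G] [Finite Ω]
    [MulAction G Ω] [FaithfulSMul G Ω] {x y z : ℕ}
    (hx : x ∈ IrrBaseSizes G Ω) (hy : y ∈ IrrBaseSizes G Ω)
    (hxz : x ≤ z) (hzy : z ≤ y) :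
    z ∈ IrrBaseSizes G Ω := by
  rw [mem_irrBaseSizes_iff] at *
  exact ChainLen.interval _ x y z _ hx hy hxz hzy
end

section
/- Let X be a finite non-empty set of positive integers. Then there exists a finite group G acting faithfully on a finite set Ω such that M(G,Ω) = X, i.e., X is exactly the set of cardinalities of minimal bases of G on Ω. -/
/-- `S ⊆ Ω` is a *base* for the action of `G` on `Ω`: the pointwise stabilizer
of `S` in `G` is trivial. -/
def IsBase (G : Type*) [Group G] {Ω : Type*} [MulAction G Ω] (S : Set Ω) : Prop :=
  ∀ g : G, (∀ x ∈ S, g • x = x) → g = 1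

/-- `S` is a *minimal base*: a base no proper subset of which is a base. -/
def IsMinBase (G : Type*) [Group G] {Ω : Type*} [MulAction G Ω] (S : Set Ω) : Prop :=
  IsBase G S ∧ ∀ T : Set Ω, T ⊂ S → ¬ IsBase G T

/-- `𝓜(G,Ω)`: the set of cardinalities of minimal bases of `G` on `Ω`. -/
def MinBaseSizes (G : Type*) [Group G] (Ω : Type*) [MulAction G Ω] : Set ℕ :=
  {n | ∃ S : Set Ω, IsMinBase G S ∧ S.ncard = n}

/-- `b(G,Ω)`: the minimum cardinality of a (minimal) base of `G` on `Ω`. -/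
noncomputable def minBaseSize (G : Type*) [Group G] (Ω : Type*) [MulAction G Ω] : ℕ :=
  sInf (MinBaseSizes G Ω)

/-- `B(G,Ω)`: the maximum cardinality of a minimal base of `G` on `Ω`. -/
noncomputable def maxMinBaseSize (G : Type*) [Group G] (Ω : Type*) [MulAction G Ω] : ℕ :=
  sSup (MinBaseSizes G Ω)

namespace MinBaseConstr

open Classical in
/-- The translation permutation attached to `g`. -/
noncomputable def tr (X : Set ℕ) (g : ((x : X) → Fin x.1) → ZMod 2) :
    Equiv.Perm ((Σ x : X, Fin x.1) × (((x : X) → Fin x.1) → ZMod 2)) where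
  toFun p := (p.1, fun f => p.2 f + if f p.1.1 = p.1.2 then g f else 0)
  invFun p := (p.1, fun f => p.2 f - if f p.1.1 = p.1.2 then g f else 0)
  left_inv p := by simp
  right_inv p := by simp

/-- The group of all translations. -/
noncomputable def grp (X : Set ℕ) :
    Subgroup (Equiv.Perm ((Σ x : X, Fin x.1) × (((x : X) → Fin x.1) → ZMod 2))) where
  carrier := Set.range (tr X)
  one_mem' := ⟨0, by ext p <;> simp [tr]⟩
  mul_mem' := by
    rintro _ _ ⟨a, rfl⟩ ⟨b, rfl⟩
    refine ⟨a + b, Equiv.ext fun p => Prod.ext rfl (funext fun f => ?_)⟩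
    simp only [tr, Equiv.Perm.mul_apply, Equiv.coe_fn_mk, Pi.add_apply]
    split_ifs <;> ring
  inv_mem' := by
    rintro _ ⟨a, rfl⟩
    refine ⟨-a, eq_inv_of_mul_eq_one_left (Equiv.ext fun p => Prod.ext rfl (funext fun f => ?_))⟩
    simp only [tr, Equiv.Perm.mul_apply, Equiv.coe_fn_mk, Pi.neg_apply, Equiv.Perm.one_apply]
    split_ifs <;> ring

theorem isBase_iff (X : Set ℕ) (hne : X.Nonempty)
    (S : Set ((Σ x : X, Fin x.1) × (((x : X) → Fin x.1) → ZMod 2))) :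
    IsBase (grp X) S ↔ ∃ x : X, ∀ i : Fin x.1, ∃ h, ((⟨x, i⟩, h) : (Σ x : X, Fin x.1) × _) ∈ S := by
  classical
  constructor
  · intro hS
    by_contra! hc
    choose f hf using hc
    have h1 := hS ⟨tr X (Pi.single f 1), _, rfl⟩ (by
      rintro ⟨⟨x, i⟩, h⟩ hp
      refine Prod.ext rfl (funext fun f' => ?_)
      change h f' + (if f' x = i then (Pi.single f 1 : _ → ZMod 2) f' else 0) = h f'
      split_ifs with hi
      · have : f' ≠ f := by
          rintro rfl
          subst hi
          exact hf _ _ hp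
        simp [this]
      · simp)
    obtain ⟨x, hx⟩ := hne
    have h2 := congrArg Subtype.val h1
    have h3 := congrFun (congrArg Prod.snd (Equiv.congr_fun h2 (⟨⟨x, hx⟩, f ⟨x, hx⟩⟩, 0))) f
    simp [tr] at h3
  · rintro ⟨x, hx⟩ ⟨_, g, rfl⟩ hg
    have h0 : g = 0 := by
      funext f
      obtain ⟨h, hh⟩ := hx (f x)
      have h3 := congrFun (congrArg Prod.snd (hg _ hh)) f
      change h f + (if f x = f x then g f else 0) = h f at h3
      simpa using h3
    subst h0
    refine Subtype.ext (Equiv.ext fun p => Prod.ext rfl (funext fun f => ?_))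
    simp [tr]

end MinBaseConstr

/-- **Theorem 2.** For every finite non-empty set `X` of positive integers there
is a finite group acting faithfully on a finite set (here: a subgroup `G` of the
symmetric group on a finite set `Ω`, acting naturally) whose set of cardinalities
of minimal bases is exactly `X`. -/
theorem exists_group_minBaseSizes_eq (X : Set ℕ) (hfin : X.Finite)
    (hne : X.Nonempty) (hpos : ∀ n ∈ X, 0 < n) :
    ∃ (Ω : Type) (_ : Finite Ω) (G : Subgroup (Equiv.Perm Ω)),
      MinBaseSizes G Ω = X := by
  classical
  have : Finite X := hfin
  refine ⟨(Σ x : X, Fin x.1) × (((x : X) → Fin x.1) → ZMod 2), inferInstance,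
    MinBaseConstr.grp X, ?_⟩
  have hcard : ∀ (x : X) (h : Fin x.1 → (((x : X) → Fin x.1) → ZMod 2)),
      (Set.range fun i : Fin x.1 =>
        ((⟨x, i⟩, h i) : (Σ x : X, Fin x.1) × (((x : X) → Fin x.1) → ZMod 2))).ncard = x.1 := by
    intro x h
    rw [← Set.image_univ, Set.ncard_image_of_injective, Set.ncard_univ, Nat.card_fin]
    intro i j hij
    simpa using congrArg Prod.fst hij
  ext n
  constructor
  · rintro ⟨S, ⟨hS, hmin⟩, rfl⟩
    obtain ⟨x, hx⟩ := (MinBaseConstr.isBase_iff X hne S).1 hS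
    choose h hh using hx
    have hsub : (Set.range fun i : Fin x.1 =>
        ((⟨x, i⟩, h i) : (Σ x : X, Fin x.1) × (((x : X) → Fin x.1) → ZMod 2))) ⊆ S := by
      rintro _ ⟨i, rfl⟩
      exact hh i
    rcases hsub.eq_or_ssubset with he | hlt
    · rw [← he, hcard]
      exact x.2
    · exact absurd ((MinBaseConstr.isBase_iff X hne _).2
        ⟨x, fun i => ⟨h i, Set.mem_range_self i⟩⟩) (hmin _ hlt)
  · intro hn
    refine ⟨Set.range fun i : Fin n => ((⟨⟨n, hn⟩, i⟩, 0) :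
      (Σ x : X, Fin x.1) × (((x : X) → Fin x.1) → ZMod 2)),
      ⟨(MinBaseConstr.isBase_iff X hne _).2 ⟨⟨n, hn⟩, fun i => ⟨0, i, rfl⟩⟩, ?_⟩,
      hcard ⟨n, hn⟩ fun _ => 0⟩
    intro T hT hb
    obtain ⟨y, hy⟩ := (MinBaseConstr.isBase_iff X hne _).1 hb
    obtain ⟨h, hh⟩ := hy ⟨0, hpos _ y.2⟩
    obtain ⟨j, hj⟩ := hT.1 hh
    have hyn : (⟨n, hn⟩ : X) = y := congrArg (fun p => p.1.1) hj
    subst hyn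
    apply hT.2
    rintro _ ⟨i, rfl⟩
    obtain ⟨h', hh'⟩ := hy i
    obtain ⟨k, hk⟩ := hT.1 hh'
    have h0 : (0 : ((x : X) → Fin x.1) → ZMod 2) = h' := congrArg Prod.snd hk
    subst h0
    exact hh'
end

section
/- Let X be a finite non-empty interval of positive integers (that is, X = {a, a+1, …, b} for some integers 2 ≤ a ≤ b) not containing 1. Then there exists a finite group G acting faithfully and transitively on a finite set Ω such that M(G,Ω) = X. -/
/-- The product of symmetric groups in its product action, as a subgroup of `Perm`. -/
noncomputable def prodGroup {ι : Type} (m : ι → ℕ) :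
    Subgroup (Equiv.Perm (∀ c, Fin (m c + 1))) :=
  (MulAction.toPermHom (∀ c, Equiv.Perm (Fin (m c + 1))) (∀ c, Fin (m c + 1))).range

theorem prodGroup_isBase_iff {ι : Type} (m : ι → ℕ) (S : Set (∀ c, Fin (m c + 1))) :
    IsBase (prodGroup m) S ↔
      ∀ c, ∀ p q : Fin (m c + 1), (∀ x ∈ S, x c ≠ p ∧ x c ≠ q) → p = q := by
  classical
  constructor
  · intro h c p q hpq
    by_contra hne
    have h1 := h ⟨MulAction.toPermHom (∀ c, Equiv.Perm (Fin (m c + 1))) (∀ c, Fin (m c + 1))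
      (Pi.mulSingle c (Equiv.swap p q)), ⟨_, rfl⟩⟩ (by
        intro x hx
        change (Pi.mulSingle c (Equiv.swap p q) : ∀ c, Equiv.Perm (Fin (m c + 1))) • x = x
        funext d
        rw [Pi.smul_apply']
        by_cases hd : d = c
        · subst hd
          rw [Pi.mulSingle_eq_same]
          exact Equiv.swap_apply_of_ne_of_ne (hpq x hx).1 (hpq x hx).2
        · rw [Pi.mulSingle_eq_of_ne hd, one_smul])
    have h2 := congrArg (fun g : prodGroup m =>
      (g : Equiv.Perm (∀ c, Fin (m c + 1))) (Function.update (fun _ => 0) c p) c) h1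
    change ((Pi.mulSingle c (Equiv.swap p q) : ∀ c, Equiv.Perm (Fin (m c + 1))) •
      (Function.update (fun _ => 0) c p : ∀ c, Fin (m c + 1))) c =
      (Function.update (fun _ => 0) c p : ∀ c, Fin (m c + 1)) c at h2
    rw [Pi.smul_apply', Pi.mulSingle_eq_same, Function.update_self] at h2
    change Equiv.swap p q p = p at h2
    rw [Equiv.swap_apply_left] at h2
    exact hne h2.symm
  · rintro h ⟨_, σ, rfl⟩ hg
    have hσ : σ = 1 := by
      funext c
      ext1 p
      by_contra hne
      have hne' : σ c p ≠ p := hne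
      refine hne' (h c (σ c p) p ?_)
      intro x hx
      have h1 : σ c (x c) = x c := congrFun (hg x hx) c
      constructor
      · intro h2
        rw [h2] at h1
        exact hne' ((σ c).injective h1)
      · intro h2
        rw [h2] at h1
        exact hne' h1
    subst hσ
    ext1
    exact map_one _

theorem prodGroup_pretransitive {ι : Type} (m : ι → ℕ) :
    MulAction.IsPretransitive (prodGroup m) (∀ c, Fin (m c + 1)) := by
  constructor
  intro x y
  refine ⟨⟨_, fun c => Equiv.swap (x c) (y c), rfl⟩, ?_⟩
  funext c
  exact Equiv.swap_apply_left _ _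

theorem prodGroup_isMinBase_range {ι : Type} (m : ι → ℕ) {k : ℕ}
    (v : Fin k → ∀ c, Fin (m c + 1)) (hb : IsBase (prodGroup m) (Set.range v))
    (h : ∀ i, ∃ c, ∃ p q : Fin (m c + 1), p ≠ q ∧ ∀ j, j ≠ i → v j c ≠ p ∧ v j c ≠ q) :
    k ∈ MinBaseSizes (prodGroup m) (∀ c, Fin (m c + 1)) := by
  have key : ∀ T : Set (∀ c, Fin (m c + 1)), ∀ i, (∀ x ∈ T, ∃ j, j ≠ i ∧ v j = x) →
      ¬ IsBase (prodGroup m) T := by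
    intro T i hT hTb
    obtain ⟨c, p, q, hpq, hj⟩ := h i
    refine hpq ((prodGroup_isBase_iff m T).1 hTb c p q ?_)
    intro x hx
    obtain ⟨j, hji, rfl⟩ := hT x hx
    exact hj j hji
  have hinj : Function.Injective v := by
    intro i j hij
    by_contra hne
    refine key _ i ?_ hb
    rintro _ ⟨l, rfl⟩
    by_cases hl : l = i
    · exact ⟨j, fun e => hne e.symm, by rw [hl, hij]⟩
    · exact ⟨l, hl, rfl⟩
  refine ⟨Set.range v, ⟨hb, ?_⟩, ?_⟩
  · intro T hT
    obtain ⟨hs, hn⟩ := hT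
    obtain ⟨_, ⟨i, rfl⟩, hi⟩ := Set.not_subset.1 hn
    refine key T i ?_
    intro x hx
    obtain ⟨j, rfl⟩ := hs hx
    exact ⟨j, fun e => hi (e ▸ hx), rfl⟩
  · rw [← Set.image_univ, Set.ncard_image_of_injective _ hinj, Set.ncard_univ, Nat.card_fin]

theorem prodGroup_lower {ι : Type} [Finite ι] (m : ι → ℕ) (S : Set (∀ c, Fin (m c + 1)))
    (hb : IsBase (prodGroup m) S) (c : ι) : m c ≤ S.ncard := by
  classical
  rw [prodGroup_isBase_iff] at hb
  have h1 : ((fun x : ∀ c, Fin (m c + 1) => x c) '' S)ᶜ.ncard ≤ 1 := by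
    rw [Set.ncard_le_one]
    intro p hp q hq
    refine hb c p q fun x hx => ⟨fun e => hp ⟨x, hx, e⟩, fun e => hq ⟨x, hx, e⟩⟩
  have h2 := Set.ncard_add_ncard_compl ((fun x : ∀ c, Fin (m c + 1) => x c) '' S)
  have h3 := Set.ncard_image_le (f := fun x : ∀ c, Fin (m c + 1) => x c) (Set.toFinite S)
  rw [Nat.card_fin] at h2
  omega

theorem prodGroup_upper {ι : Type} [Fintype ι] [Nonempty ι] (m : ι → ℕ) (S : Set (∀ c, Fin (m c + 1)))
    (hb : IsMinBase (prodGroup m) S) (hm : ∀ c, m c < S.ncard) :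
    S.ncard ≤ ∑ c, (m c - 1) := by
  classical
  obtain ⟨hb, hmin⟩ := hb
  have hb' := (prodGroup_isBase_iff m S).1 hb
  have key : ∀ x : ∀ c, Fin (m c + 1), ∃ c, x ∈ S → (∃ q, ∀ y ∈ S, y c ≠ q) ∧
      ∀ y ∈ S, y ≠ x → y c ≠ x c := by
    intro x
    by_cases hx : x ∈ S
    swap
    · exact ⟨Classical.arbitrary ι, fun h => absurd h hx⟩
    have h1 := hmin (S \ {x}) (by
      refine ⟨Set.sdiff_subset, fun h => ?_⟩
      exact (h hx).2 rfl)
    rw [prodGroup_isBase_iff] at h1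
    push Not at h1
    obtain ⟨c, p, q, hpq, hne⟩ := h1
    refine ⟨c, fun _ => ?_⟩
    by_cases h2 : x c = p
    · refine ⟨⟨q, fun y hy => ?_⟩, fun y hy hyx => ?_⟩
      · by_cases hyx : y = x
        · subst hyx; rw [h2]; exact hne
        · exact (hpq y ⟨hy, hyx⟩).2
      · rw [h2]; exact (hpq y ⟨hy, hyx⟩).1
    · by_cases h3 : x c = q
      · refine ⟨⟨p, fun y hy => ?_⟩, fun y hy hyx => ?_⟩
        · by_cases hyx : y = x
          · subst hyx; exact h2
          · exact (hpq y ⟨hy, hyx⟩).1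
        · rw [h3]; exact (hpq y ⟨hy, hyx⟩).2
      · refine absurd (hb' c p q fun y hy => ?_) hne
        by_cases hyx : y = x
        · subst hyx; exact ⟨h2, h3⟩
        · exact hpq y ⟨hy, hyx⟩
  choose f hf using key
  set s : Finset (∀ c, Fin (m c + 1)) := S.toFinset with hs
  have hS : S.ncard = s.card := Set.ncard_eq_toFinset_card' S
  rw [hS] at hm ⊢
  have hmem : ∀ x, x ∈ s ↔ x ∈ S := fun x => Set.mem_toFinset
  rw [Finset.card_eq_sum_card_fiberwise (f := f) (t := Finset.univ) (fun _ _ => Finset.mem_univ _)]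
  refine Finset.sum_le_sum fun c _ => ?_
  set F := s.filter (fun x => f x = c) with hF
  have hinj : (F.image fun x => x c).card = F.card := by
    refine Finset.card_image_of_injOn ?_
    intro x hx y hy hxy
    simp only [hF, Finset.coe_filter, Set.mem_ofPred_eq, hmem] at hx hy
    by_contra hne
    have := (hf y hy.1).2 x hx.1 hne
    rw [hy.2] at this
    exact this hxy
  rcases F.eq_empty_or_nonempty with h0 | ⟨x0, hx0⟩
  · rw [h0]; simp
  have hx0' := hx0
  rw [hF, Finset.mem_filter, hmem] at hx0'
  have hex := (hf x0 hx0'.1).1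
  rw [hx0'.2] at hex
  obtain ⟨q, hq⟩ := hex
  by_cases hFs : F = s
  · have h1 : (F.image fun x => x c) ⊆ Finset.univ.erase q := by
      intro p hp
      obtain ⟨x, hx, rfl⟩ := Finset.mem_image.1 hp
      refine Finset.mem_erase.2 ⟨?_, Finset.mem_univ _⟩
      exact hq x ((hmem x).1 (hFs ▸ hx))
    have h2 := Finset.card_le_card h1
    rw [Finset.card_erase_of_mem (Finset.mem_univ _), hinj, hFs, Finset.card_univ,
      Fintype.card_fin] at h2
    have := hm c
    omega
  · obtain ⟨y, hy, hyF⟩ : ∃ y ∈ s, y ∉ F := by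
      by_contra hcon
      push Not at hcon
      exact hFs (Finset.Subset.antisymm (Finset.filter_subset _ _) hcon)
    have h1 : (F.image fun x => x c) ⊆ (Finset.univ.erase q).erase (y c) := by
      intro p hp
      obtain ⟨x, hx, rfl⟩ := Finset.mem_image.1 hp
      have hx' := hx
      rw [hF, Finset.mem_filter, hmem] at hx'
      refine Finset.mem_erase.2 ⟨?_, Finset.mem_erase.2 ⟨hq x hx'.1, Finset.mem_univ _⟩⟩
      have h3 := (hf x hx'.1).2 y ((hmem y).1 hy) (fun e => hyF (e ▸ hx))
      rw [hx'.2] at h3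
      exact h3.symm
    have h2 := Finset.card_le_card h1
    rw [Finset.card_erase_of_mem (Finset.mem_erase.2 ⟨hq y ((hmem y).1 hy), Finset.mem_univ _⟩),
      Finset.card_erase_of_mem (Finset.mem_univ _), hinj, Finset.card_univ,
      Fintype.card_fin] at h2
    omega

/-- Degrees (minus one) of the factors: one `S_{a+1}` and `n` copies of `S_3`. -/
def degs (a n : ℕ) : Option (Fin n) → ℕ
  | none => a
  | some _ => 2

/-- The points of the minimal base of size `k`. -/
def pts (a n k : ℕ) (i : ℕ) : ∀ c, Fin (degs a n c + 1)
  | none => (⟨min i (a - 1), by omega⟩ : Fin (a + 1))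
  | some j => if i = a - 1 + min j.1 (k - a) then (1 : Fin 3) else (0 : Fin 3)

theorem pts_some_pos (a n k i : ℕ) (j : Fin n) (h : i = a - 1 + min j.1 (k - a)) :
    pts a n k i (some j) = (1 : Fin 3) := if_pos h

theorem pts_some_neg (a n k i : ℕ) (j : Fin n) (h : i ≠ a - 1 + min j.1 (k - a)) :
    pts a n k i (some j) = (0 : Fin 3) := if_neg h

theorem fin_three_aux : ∀ p q : Fin 3, ((0 : Fin 3) ≠ p ∧ (0 : Fin 3) ≠ q) →
    ((1 : Fin 3) ≠ p ∧ (1 : Fin 3) ≠ q) → p = q := by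
  decide

/-- **Theorem 3 (minimal bases).** For every interval `X = {a, a+1, …, b}` of
positive integers with `2 ≤ a ≤ b` (so `1 ∉ X`), there is a finite group acting
faithfully and transitively on a finite set (here: a transitive subgroup `G` of
the symmetric group on a finite set `Ω`) whose set of cardinalities of minimal
bases is exactly `X`. -/
theorem exists_transitive_group_minBaseSizes_eq_Icc (a b : ℕ) (ha : 2 ≤ a)
    (hab : a ≤ b) :
    ∃ (Ω : Type) (_ : Finite Ω) (G : Subgroup (Equiv.Perm Ω)),
      MulAction.IsPretransitive G Ω ∧ MinBaseSizes G Ω = Set.Icc a b := by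
  classical
  obtain ⟨n, hn⟩ : ∃ n, n = b - a + 1 := ⟨_, rfl⟩
  refine ⟨∀ c, Fin (degs a n c + 1), inferInstance, prodGroup (degs a n),
    prodGroup_pretransitive _, ?_⟩
  ext k
  rw [Set.mem_Icc]
  constructor
  · rintro ⟨S, hS, rfl⟩
    refine ⟨prodGroup_lower (degs a n) S hS.1 none, ?_⟩
    by_contra hlt
    have h := prodGroup_upper (degs a n) S hS
    generalize S.ncard = N at hlt h
    replace h := h (by
      rintro (_ | j)
      · simp only [degs]; omega
      · simp only [degs]; omega)
    rw [Fintype.sum_option] at h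
    simp only [degs, Finset.sum_const, Finset.card_univ, Fintype.card_fin, smul_eq_mul] at h
    omega
  · rintro ⟨hak, hkb⟩
    refine prodGroup_isMinBase_range (degs a n) (fun i : Fin k => pts a n k i) ?_ ?_
    · rw [prodGroup_isBase_iff]
      rintro (_ | j)
      · have hp : ∀ p : Fin (a + 1), (∀ i : Fin k, pts a n k i none ≠ p) → p.1 = a := by
          intro p hp
          by_contra hne
          have := p.2
          refine hp ⟨p.1, by omega⟩ ?_
          apply Fin.ext
          change min p.1 (a - 1) = p.1
          omega
        intro p q hpq
        apply Fin.ext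
        rw [hp p fun i => (hpq _ ⟨i, rfl⟩).1, hp q fun i => (hpq _ ⟨i, rfl⟩).2]
      · intro p q hpq
        have h0 := hpq _ ⟨⟨0, by omega⟩, rfl⟩
        have h1 := hpq _ ⟨⟨a - 1 + min j.1 (k - a), by omega⟩, rfl⟩
        have e0 := pts_some_neg a n k 0 j (by omega)
        have e1 := pts_some_pos a n k _ j rfl
        exact fin_three_aux p q ⟨fun e => h0.1 (e0.trans e), fun e => h0.2 (e0.trans e)⟩
          ⟨fun e => h1.1 (e1.trans e), fun e => h1.2 (e1.trans e)⟩
    · intro i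
      by_cases hi : i.1 < a - 1
      · refine ⟨none, (⟨i.1, by omega⟩ : Fin (a + 1)), (⟨a, by omega⟩ : Fin (a + 1)), ?_, ?_⟩
        · intro h
          have := congrArg Fin.val h
          simp only at this
          omega
        · intro j hj
          have hj' : j.1 ≠ i.1 := fun h => hj (Fin.ext h)
          constructor
          · intro h
            have h' : min j.1 (a - 1) = i.1 := congrArg Fin.val h
            omega
          · intro h
            have h' : min j.1 (a - 1) = a := congrArg Fin.val h
            omega
      · have := i.2
        refine ⟨some ⟨i.1 - (a - 1), by omega⟩, (1 : Fin 3), (2 : Fin 3), ?_, ?_⟩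
        · change (1 : Fin 3) ≠ 2
          decide
        · intro j hj
          have hj' : j.1 ≠ i.1 := fun h => hj (Fin.ext h)
          have e0 := pts_some_neg a n k j.1 ⟨i.1 - (a - 1), by omega⟩ (by
            simp only
            omega)
          have d1 : (0 : Fin 3) ≠ 1 := by decide
          have d2 : (0 : Fin 3) ≠ 2 := by decide
          exact ⟨fun e => d1 (e0.symm.trans e), fun e => d2 (e0.symm.trans e)⟩
end

section
/- Let X be a finite non-empty interval of positive integers (that is, X = {a, a+1, …, b} for some integers 2 ≤ a ≤ b) not containing 1. Then there exists a finite group H acting faithfully and transitively on a finite set Δ such that I(H,Δ) = X. -/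
namespace IrrBaseAux

/-- The set acted on. -/
abbrev V (c m : ℕ) : Type := (Fin c → ZMod 2) × ZMod 2 × (Fin m → ZMod 3)

/-- The permutation `(u,t,z) ↦ (u + w, t + l·u + s, ε z + y)`. -/
def mk {c m : ℕ} (w : Fin c → ZMod 2) (s : ZMod 2) (y : Fin m → ZMod 3)
    (l : Fin c → ZMod 2) (e : Fin m → (ZMod 3)ˣ) : Equiv.Perm (V c m) where
  toFun x := (x.1 + w, x.2.1 + l ⬝ᵥ x.1 + s, fun i => (e i : ZMod 3) * x.2.2 i + y i)
  invFun x := (x.1 - w, x.2.1 - l ⬝ᵥ (x.1 - w) - s,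
    fun i => ((e i)⁻¹ : (ZMod 3)ˣ) * (x.2.2 i - y i))
  left_inv x := by
    refine Prod.ext ?_ (Prod.ext ?_ (funext fun i => ?_))
    · exact add_sub_cancel_right _ _
    · simp only [add_sub_cancel_right]
      ring
    · simp only [add_sub_cancel_right]
      rw [← mul_assoc, Units.inv_mul, one_mul]
  right_inv x := by
    refine Prod.ext ?_ (Prod.ext ?_ (funext fun i => ?_))
    · exact sub_add_cancel _ _
    · simp only []
      ring
    · simp only []
      rw [← mul_assoc, Units.mul_inv, one_mul, sub_add_cancel]

theorem mk_apply {c m : ℕ} (w : Fin c → ZMod 2) (s : ZMod 2) (y : Fin m → ZMod 3)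
    (l : Fin c → ZMod 2) (e : Fin m → (ZMod 3)ˣ) (x : V c m) :
    mk w s y l e x =
      (x.1 + w, x.2.1 + l ⬝ᵥ x.1 + s, fun i => (e i : ZMod 3) * x.2.2 i + y i) := rfl

/-- The group. -/
def H (c m : ℕ) : Subgroup (Equiv.Perm (V c m)) where
  carrier := {g | ∃ w s y l e, g = mk w s y l e}
  one_mem' := ⟨0, 0, 0, 0, 1, by ext x <;> simp [mk_apply]⟩
  mul_mem' := by
    rintro _ _ ⟨w, s, y, l, e, rfl⟩ ⟨w', s', y', l', e', rfl⟩
    refine ⟨w + w', s + s' + l ⬝ᵥ w', fun i => e i * y' i + y i, l + l', e * e', ?_⟩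
    ext x
    · simp [mk_apply]; ring
    · simp [mk_apply, dotProduct_add, add_dotProduct]; ring
    · simp [mk_apply]; ring
  inv_mem' := by
    rintro _ ⟨w, s, y, l, e, rfl⟩
    refine ⟨-w, l ⬝ᵥ w - s, fun i => - (((e i)⁻¹ : (ZMod 3)ˣ) * y i), -l, e⁻¹, ?_⟩
    rw [inv_eq_iff_mul_eq_one]
    refine Equiv.ext fun x => ?_
    rw [Equiv.Perm.mul_apply, mk_apply, mk_apply, Equiv.Perm.one_apply]
    refine Prod.ext ?_ (Prod.ext ?_ (funext fun i => ?_))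
    · exact neg_add_cancel_right _ _
    · simp only [dotProduct_add, neg_dotProduct, dotProduct_neg]
      ring
    · simp only [Pi.inv_apply, mul_add, mul_neg]
      rw [← mul_assoc, ← mul_assoc, Units.mul_inv, one_mul, one_mul, neg_add_cancel_right]

theorem mk_mem {c m : ℕ} (w : Fin c → ZMod 2) (s : ZMod 2) (y : Fin m → ZMod 3)
    (l : Fin c → ZMod 2) (e : Fin m → (ZMod 3)ˣ) : mk w s y l e ∈ H c m :=
  ⟨w, s, y, l, e, rfl⟩

theorem trans (c m : ℕ) : MulAction.IsPretransitive (H c m) (V c m) := by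
  refine ⟨fun x x' => ⟨⟨mk (x'.1 - x.1) (x'.2.1 - x.2.1) (x'.2.2 - x.2.2) 0 1,
    mk_mem _ _ _ _ _⟩, ?_⟩⟩
  change mk _ _ _ _ _ x = x'
  ext <;> simp [mk_apply]

theorem fix_iff {c m : ℕ} (w : Fin c → ZMod 2) (s : ZMod 2) (y : Fin m → ZMod 3)
    (l : Fin c → ZMod 2) (e : Fin m → (ZMod 3)ˣ) (x : V c m) :
    mk w s y l e x = x ↔
      w = 0 ∧ l ⬝ᵥ x.1 + s = 0 ∧ ∀ i, (e i : ZMod 3) * x.2.2 i + y i = x.2.2 i := by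
  rw [mk_apply, Prod.ext_iff, Prod.ext_iff]
  simp only [add_assoc, add_eq_left]
  rw [funext_iff (g := x.2.2)]

theorem card_stab (c m : ℕ) (x : V c m) :
    Nat.card (MulAction.stabilizer (H c m) x) ≤ 2 ^ (c + m) := by
  have h : ∀ g : MulAction.stabilizer (H c m) x, ∃ p : (Fin c → ZMod 2) × (Fin m → (ZMod 3)ˣ),
      (g.1.1 : Equiv.Perm (V c m)) =
        mk 0 (-(p.1 ⬝ᵥ x.1)) (fun i => x.2.2 i - (p.2 i : ZMod 3) * x.2.2 i) p.1 p.2 := by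
    rintro ⟨⟨_, w, s, y, l, e, rfl⟩, hg⟩
    have hg' : mk w s y l e x = x := hg
    rw [fix_iff] at hg'
    obtain ⟨rfl, h2, h3⟩ := hg'
    refine ⟨(l, e), ?_⟩
    have hs : s = -(l ⬝ᵥ x.1) := by linear_combination h2
    have hy : y = fun i => x.2.2 i - (e i : ZMod 3) * x.2.2 i := by
      ext i; linear_combination h3 i
    subst hs hy
    rfl
  choose f hf using h
  have hinj : Function.Injective f := by
    intro g g' hgg
    apply Subtype.ext; apply Subtype.ext
    rw [hf g, hf g', hgg]
  have := Nat.card_le_card_of_injective f hinj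
  refine this.trans (le_of_eq ?_)
  have h3 : Nat.card (ZMod 3)ˣ = 2 := by
    rw [Nat.card_eq_fintype_card]; decide
  rw [Nat.card_prod, Nat.card_fun, Nat.card_fun, h3]
  simp [pow_add]

theorem upper {c m n : ℕ} (ω : Fin n → V c m) (h : IsIrrBase (H c m) ω) :
    n ≤ c + m + 1 := by
  rcases n with _ | n
  · omega
  let G : ℕ → Subgroup (H c m) := fun i =>
    ⨅ j ∈ {j : Fin (n+1) | (j : ℕ) ≤ i}, MulAction.stabilizer (H c m) (ω j)
  have hlt : ∀ i, i < n → G (i+1) < G i := by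
    intro i hi
    have := h.1 ⟨i+1, by omega⟩
    simpa only [G, Fin.le_def, Fin.lt_def, Nat.lt_succ_iff] using this
  have hcard : ∀ i, i ≤ n → Nat.card (G i) * 2 ^ i ≤ 2 ^ (c + m) := by
    intro i
    induction i with
    | zero =>
      intro _
      rw [pow_zero, mul_one]
      refine le_trans ?_ (card_stab c m (ω 0))
      apply Nat.le_of_dvd Nat.card_pos
      apply Subgroup.card_dvd_of_le
      exact iInf₂_le (0 : Fin (n+1)) (by simp)
    | succ i ih =>
      intro hi
      have h1 := hlt i (by omega)
      have h2 := ih (by omega)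
      have hd := Subgroup.card_dvd_of_le h1.le
      have hne : Nat.card (G (i+1)) ≠ Nat.card (G i) := by
        intro he
        exact h1.ne (Subgroup.eq_of_le_of_card_ge h1.le he.ge)
      obtain ⟨k, hk⟩ := hd
      have hpos : 0 < Nat.card (G i) := Nat.card_pos
      have hk2 : 2 ≤ k := by
        rcases k with _ | _ | k
        · omega
        · simp at hk; omega
        · omega
      calc Nat.card (G (i+1)) * 2 ^ (i+1) = (Nat.card (G (i+1)) * 2) * 2 ^ i := by ring
        _ ≤ (Nat.card (G (i+1)) * k) * 2 ^ i := by gcongr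
        _ = Nat.card (G i) * 2 ^ i := by rw [hk]
        _ ≤ _ := h2
  have h1 := hcard n le_rfl
  have h2 : 0 < Nat.card (G n) := Nat.card_pos
  have h3 : 2 ^ n ≤ 2 ^ (c + m) := le_trans (Nat.le_mul_of_pos_left _ h2) h1
  have := (Nat.pow_le_pow_iff_right (by norm_num : 1 < 2)).1 h3
  omega

theorem lower {c m n : ℕ} (ω : Fin n → V c m) (h : IsIrrBase (H c m) ω) :
    c + 1 ≤ n := by
  by_contra hn
  have hb := h.2
  -- affine functions `u ↦ l·u + s` vanishing at all points
  let F : (Fin c → ZMod 2) × ZMod 2 → (Fin n → ZMod 2) := fun p j => p.1 ⬝ᵥ (ω j).1 + p.2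
  have hF : ¬ Function.Injective F := by
    intro hi
    have := Nat.card_le_card_of_injective F hi
    simp [Nat.card_prod, Nat.card_fun] at this
    rw [← pow_succ, Nat.pow_le_pow_iff_right (by norm_num : 1 < 2)] at this
    omega
  simp only [Function.Injective, not_forall] at hF
  obtain ⟨p, q, hpq, hne⟩ := hF
  have hm : (⟨mk 0 (p.2 - q.2) 0 (p.1 - q.1) 1, mk_mem _ _ _ _ _⟩ : H c m) ∈
      ⨅ j, MulAction.stabilizer (H c m) (ω j) := by
    rw [Subgroup.mem_iInf]
    intro j
    change mk _ _ _ _ _ (ω j) = ω j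
    rw [fix_iff]
    have := congrFun hpq j
    simp only [F] at this
    refine ⟨rfl, ?_, by simp⟩
    rw [sub_dotProduct]
    linear_combination this
  rw [hb, Subgroup.mem_bot, Subtype.ext_iff] at hm
  have hm' : ∀ x, mk 0 (p.2 - q.2) 0 (p.1 - q.1) (1 : Fin m → (ZMod 3)ˣ) x = x := by
    intro x; exact congrArg (fun g : Equiv.Perm (V c m) => g x) hm
  simp only [fix_iff] at hm'
  have h0 : p.2 - q.2 = 0 := by simpa using (hm' (0, 0, 0)).2.1
  apply hne
  ext i
  · have := (hm' (Pi.single i 1, 0, 0)).2.1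
    rw [h0] at this
    simpa [sub_eq_zero] using this
  · exact sub_eq_zero.1 h0

/-- The base of length `c + 1 + k`. -/
def base (c m k : ℕ) (j : Fin (c + 1 + k)) : V c m :=
  (fun i => if (j : ℕ) = i + 1 then 1 else 0, 0,
   fun i => if 1 ≤ (j : ℕ) ∧ (j : ℕ) ≤ c then (if k ≤ (i : ℕ) then 1 else 0)
     else if (j : ℕ) = c + 1 + i then 1 else 0)

theorem isIrrBase_base (c m k : ℕ) (hc : 1 ≤ c) (hk : k ≤ m) :
    IsIrrBase (H c m) (base c m k) := by
  constructor
  · intro i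
    refine lt_of_le_of_ne (iInf₂_mono' fun j hj => ⟨j, by simp only [Set.mem_ofPred_eq] at hj ⊢; exact hj.le, le_rfl⟩) ?_
    intro heq
    -- it suffices to exhibit an element
    have key : ∀ w s y l e, (∀ j < i, mk w s y l e (base c m k j) = base c m k j) →
        mk w s y l e (base c m k i) = base c m k i := by
      intro w s y l e hj
      have hm : (⟨mk w s y l e, mk_mem _ _ _ _ _⟩ : H c m) ∈
          ⨅ j ∈ {j | j < i}, MulAction.stabilizer (H c m) (base c m k j) := by
        simp only [Subgroup.mem_iInf]
        exact fun j hji => hj j hji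
      rw [← heq] at hm
      simp only [Subgroup.mem_iInf] at hm
      exact hm i (le_refl i)
    simp only [fix_iff] at key
    rcases Nat.eq_zero_or_pos (i : ℕ) with h0 | h0
    · have := (key 0 1 0 0 1 (by intro j hj; rw [Fin.lt_def] at hj; omega)).2.1
      simp at this
    by_cases hic : (i : ℕ) ≤ c
    · have := (key 0 0 0 (Pi.single ⟨i - 1, by omega⟩ 1) 1 (by
        intro j hj
        rw [Fin.lt_def] at hj
        refine ⟨rfl, ?_, by simp⟩
        simp [base]
        omega)).2.1
      simp [base] at this
      omega
    · have hi2 := i.2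
      have hne : ∀ j : Fin (c + 1 + k), j < i →
          (base c m k j).2.2 ⟨i - (c + 1), by omega⟩ = 0 := by
        intro j hj
        rw [Fin.lt_def] at hj
        simp only [base]
        split_ifs <;> first | rfl | omega
      have := (key 0 0 0 0 (Pi.mulSingle ⟨i - (c + 1), by omega⟩ (-1)) (by
        intro j hj
        refine ⟨rfl, by simp, ?_⟩
        intro a
        by_cases ha : a = ⟨i - (c + 1), by omega⟩
        · rw [ha, hne j hj]; simp
        · simp [Pi.mulSingle_eq_of_ne ha])).2.2 ⟨i - (c + 1), by omega⟩
      have h1 : (base c m k i).2.2 ⟨i - (c + 1), by omega⟩ = 1 := by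
        simp only [base]
        split_ifs <;> first | rfl | omega
      rw [h1, Pi.mulSingle_eq_same, Pi.zero_apply] at this
      revert this
      decide
  · rw [eq_bot_iff]
    rintro ⟨_, w, s, y, l, e, rfl⟩ hg
    rw [Subgroup.mem_iInf] at hg
    have hg' : ∀ j, mk w s y l e (base c m k j) = base c m k j := fun j => hg j
    simp only [fix_iff] at hg'
    have h0 := hg' ⟨0, by omega⟩
    have hw := h0.1
    have hb0 : base c m k ⟨0, by omega⟩ = 0 := by
      ext i <;> simp [base]
      omega
    rw [hb0] at h0
    have hs : s = 0 := by simpa using h0.2.1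
    have hy : y = 0 := by ext i; simpa using h0.2.2 i
    have hl : l = 0 := by
      ext i
      have := (hg' ⟨i + 1, by omega⟩).2.1
      have hb : (base c m k ⟨i + 1, by omega⟩).1 = Pi.single i 1 := by
        ext a
        simp [base, Pi.single_apply, Fin.ext_iff, eq_comm]
      rw [hb, hs] at this
      simpa using this
    have he : e = 1 := by
      ext i
      by_cases hik : k ≤ (i : ℕ)
      · have := (hg' ⟨1, by omega⟩).2.2 i
        simpa [base, hc, hik, hy] using this
      · have := (hg' ⟨c + 1 + i, by omega⟩).2.2 i
        have hb : (base c m k ⟨c + 1 + i, by omega⟩).2.2 i = 1 := by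
          simp only [base]
          split_ifs <;> first | rfl | omega
        rw [hb] at this
        simpa [hy] using this
    rw [Subgroup.mem_bot]
    apply Subtype.ext
    subst hw hs hy hl he
    ext x <;> simp [mk_apply]

end IrrBaseAux

theorem exists_transitive_group_irrBaseSizes_eq_Icc (a b : ℕ) (ha : 2 ≤ a)
    (hab : a ≤ b) :
    ∃ (Δ : Type) (_ : Finite Δ) (H : Subgroup (Equiv.Perm Δ)),
      MulAction.IsPretransitive H Δ ∧ IrrBaseSizes H Δ = Set.Icc a b := by
  refine ⟨IrrBaseAux.V (a - 1) (b - a), inferInstance, IrrBaseAux.H (a - 1) (b - a),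
    IrrBaseAux.trans _ _, ?_⟩
  ext n
  rw [Set.mem_Icc]
  constructor
  · rintro ⟨ω, h⟩
    have h1 := IrrBaseAux.lower ω h
    have h2 := IrrBaseAux.upper ω h
    omega
  · rintro ⟨h1, h2⟩
    obtain ⟨k, rfl⟩ : ∃ k, n = a - 1 + 1 + k := ⟨n - a, by omega⟩
    exact ⟨_, IrrBaseAux.isIrrBase_base (a - 1) (b - a) k (by omega) (by omega)⟩
end

section
/- Let G and H be finite groups acting faithfully on finite sets Δ and Λ respectively, and let G × H act on the disjoint union Δ ⊔ Λ by (g,h) acting as g on Δ and as h on Λ. Then M(G × H, Δ ⊔ Λ) = {a + b : a ∈ M(G,Δ), b ∈ M(H,Λ)}. -/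
/-- The action of `G × H` on the disjoint union `Δ ⊕ Λ`: `(g,h)` acts as `g`
on `Δ` and as `h` on `Λ`. -/
instance Prod.sumSMul {G H Δ Λ : Type*} [Group G] [Group H] [MulAction G Δ]
    [MulAction H Λ] : SMul (G × H) (Δ ⊕ Λ) :=
  ⟨fun p x => Sum.map (fun d => p.1 • d) (fun l => p.2 • l) x⟩

instance Prod.sumMulAction {G H Δ Λ : Type*} [Group G] [Group H] [MulAction G Δ]
    [MulAction H Λ] : MulAction (G × H) (Δ ⊕ Λ) where
  one_smul x := by
    cases x with
    | inl d => show Sum.inl ((1 : G) • d) = _; rw [one_smul]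
    | inr l => show Sum.inr ((1 : H) • l) = _; rw [one_smul]
  mul_smul p q x := by
    cases x with
    | inl d => show Sum.inl ((p.1 * q.1) • d) = _; rw [mul_smul]; rfl
    | inr l => show Sum.inr ((p.2 * q.2) • l) = _; rw [mul_smul]; rfl

theorem isBase_sum_iff {G H Δ Λ : Type*} [Group G] [Group H] [MulAction G Δ]
    [MulAction H Λ] (A : Set Δ) (B : Set Λ) :
    IsBase (G × H) (Sum.inl '' A ∪ Sum.inr '' B : Set (Δ ⊕ Λ)) ↔ IsBase G A ∧ IsBase H B := by
  have hl : ∀ (p : G × H) (d : Δ), p • (Sum.inl d : Δ ⊕ Λ) = Sum.inl (p.1 • d) :=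
    fun _ _ => rfl
  have hr : ∀ (p : G × H) (d : Λ), p • (Sum.inr d : Δ ⊕ Λ) = Sum.inr (p.2 • d) :=
    fun _ _ => rfl
  constructor
  · intro h
    constructor
    · intro g hg
      have := h (g, 1) (by
        rintro x (⟨d, hd, rfl⟩ | ⟨d, hd, rfl⟩)
        · rw [hl, hg d hd]
        · rw [hr, one_smul])
      exact congrArg Prod.fst this
    · intro g hg
      have := h (1, g) (by
        rintro x (⟨d, hd, rfl⟩ | ⟨d, hd, rfl⟩)
        · rw [hl, one_smul]
        · rw [hr, hg d hd])
      exact congrArg Prod.snd this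
  · rintro ⟨h1, h2⟩ p hp
    refine Prod.ext (h1 _ fun d hd => ?_) (h2 _ fun d hd => ?_)
    · exact Sum.inl_injective (hp _ (Or.inl ⟨d, hd, rfl⟩))
    · exact Sum.inr_injective (hp _ (Or.inr ⟨d, hd, rfl⟩))

theorem sum_set_eq {Δ Λ : Type*} (S : Set (Δ ⊕ Λ)) :
    S = Sum.inl '' (Sum.inl ⁻¹' S) ∪ Sum.inr '' (Sum.inr ⁻¹' S) := by
  ext x
  cases x <;> simp

theorem sum_set_subset {Δ Λ : Type*} (A A' : Set Δ) (B B' : Set Λ) :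
    (Sum.inl '' A ∪ Sum.inr '' B : Set (Δ ⊕ Λ)) ⊆ Sum.inl '' A' ∪ Sum.inr '' B' ↔
      A ⊆ A' ∧ B ⊆ B' := by
  simp [Set.subset_def]

theorem isMinBase_sum_iff {G H Δ Λ : Type*} [Group G] [Group H] [MulAction G Δ]
    [MulAction H Λ] (A : Set Δ) (B : Set Λ) :
    IsMinBase (G × H) (Sum.inl '' A ∪ Sum.inr '' B : Set (Δ ⊕ Λ)) ↔
      IsMinBase G A ∧ IsMinBase H B := by
  constructor
  · rintro ⟨h, hm⟩
    obtain ⟨hA, hB⟩ := (isBase_sum_iff A B).1 h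
    refine ⟨⟨hA, fun T hT hb => ?_⟩, ⟨hB, fun T hT hb => ?_⟩⟩
    · refine hm (Sum.inl '' T ∪ Sum.inr '' B) ⟨?_, ?_⟩ ((isBase_sum_iff T B).2 ⟨hb, hB⟩)
      · exact (sum_set_subset _ _ _ _).2 ⟨hT.1, subset_rfl⟩
      · exact fun h => hT.2 ((sum_set_subset _ _ _ _).1 h).1
    · refine hm (Sum.inl '' A ∪ Sum.inr '' T) ⟨?_, ?_⟩ ((isBase_sum_iff A T).2 ⟨hA, hb⟩)
      · exact (sum_set_subset _ _ _ _).2 ⟨subset_rfl, hT.1⟩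
      · exact fun h => hT.2 ((sum_set_subset _ _ _ _).1 h).2
  · rintro ⟨⟨hA, hmA⟩, ⟨hB, hmB⟩⟩
    refine ⟨(isBase_sum_iff A B).2 ⟨hA, hB⟩, fun T hT hb => ?_⟩
    rw [sum_set_eq T] at hT hb
    obtain ⟨h1, h2⟩ := (isBase_sum_iff _ _).1 hb
    obtain ⟨s1, s2⟩ := (sum_set_subset _ _ _ _).1 hT.1
    refine hT.2 ((sum_set_subset _ _ _ _).2 ⟨?_, ?_⟩)
    · by_contra hc
      exact hmA _ ⟨s1, hc⟩ h1
    · by_contra hc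
      exact hmB _ ⟨s2, hc⟩ h2

theorem sum_set_ncard {Δ Λ : Type*} [Finite Δ] [Finite Λ] (A : Set Δ) (B : Set Λ) :
    (Sum.inl '' A ∪ Sum.inr '' B : Set (Δ ⊕ Λ)).ncard = A.ncard + B.ncard := by
  rw [Set.ncard_union_eq, Set.ncard_image_of_injective _ Sum.inl_injective,
    Set.ncard_image_of_injective _ Sum.inr_injective]
  rw [Set.disjoint_left]
  rintro x ⟨a, _, rfl⟩ ⟨b, _, hb⟩
  exact Sum.inr_ne_inl hb

/-- **Lemma 2.1.** For `G × H` acting on the disjoint union `Δ ⊔ Λ`, the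
cardinalities of minimal bases are exactly the sums `a + b` where `a` is the
cardinality of a minimal base of `G` on `Δ` and `b` of `H` on `Λ`. -/
theorem minBaseSizes_sumAction {G H Δ Λ : Type*} [Group G] [Group H]
    [Finite G] [Finite H] [Finite Δ] [Finite Λ] [MulAction G Δ] [MulAction H Λ]
    [FaithfulSMul G Δ] [FaithfulSMul H Λ] :
    MinBaseSizes (G × H) (Δ ⊕ Λ) =
      {n | ∃ a ∈ MinBaseSizes G Δ, ∃ b ∈ MinBaseSizes H Λ, n = a + b} := by
  ext n
  constructor
  · rintro ⟨S, hS, rfl⟩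
    rw [sum_set_eq S] at hS ⊢
    obtain ⟨h1, h2⟩ := (isMinBase_sum_iff _ _).1 hS
    exact ⟨_, ⟨_, h1, rfl⟩, _, ⟨_, h2, rfl⟩, sum_set_ncard _ _⟩
  · rintro ⟨a, ⟨A, hA, rfl⟩, b, ⟨B, hB, rfl⟩, rfl⟩
    exact ⟨_, (isMinBase_sum_iff A B).2 ⟨hA, hB⟩, sum_set_ncard A B⟩
end

section
/- Let G and H be finite groups acting faithfully on finite sets Δ and Λ respectively, and let G × H act on Δ × Λ by the product action. Then B(G × H, Δ × Λ) ≤ B(G,Δ) + B(H,Λ); that is, every minimal base of G × H on Δ × Λ has cardinality at most B(G,Δ) + B(H,Λ). -/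
/-- The *product action* of `G × H` on `Δ × Λ`: `(δ,λ)^(g,h) = (δ^g, λ^h)`. -/
instance Prod.prodSMul {G H Δ Λ : Type*} [Group G] [Group H] [MulAction G Δ]
    [MulAction H Λ] : SMul (G × H) (Δ × Λ) :=
  ⟨fun p x => (p.1 • x.1, p.2 • x.2)⟩

instance Prod.prodMulAction {G H Δ Λ : Type*} [Group G] [Group H] [MulAction G Δ]
    [MulAction H Λ] : MulAction (G × H) (Δ × Λ) where
  one_smul x := by
    show ((1 : G) • x.1, (1 : H) • x.2) = x
    simp
  mul_smul p q x := by
    show ((p.1 * q.1) • x.1, (p.2 * q.2) • x.2) = (p.1 • q.1 • x.1, p.2 • q.2 • x.2)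
    simp [mul_smul]

theorem maxMinBase_aux {G Δ X : Type*} [Group G] [Finite Δ] [MulAction G Δ]
    (f : X → Δ) (S A : Set X) (hb : IsBase G (f '' S)) (hAS : A ⊆ S)
    (hA : ∀ x ∈ A, ∃ g : G, g ≠ 1 ∧ ∀ y ∈ S, y ≠ x → g • f y = f y) :
    A.ncard ≤ maxMinBaseSize G Δ := by
  obtain ⟨T, hTS, hT⟩ := exists_minimal_le_of_wellFoundedLT (fun T : Set Δ => IsBase G T) _ hb
  have hmin : IsMinBase G T := ⟨hT.prop, fun U hU hUb => hU.2 (hT.le_of_le hUb hU.1)⟩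
  have hinj : Set.InjOn f A := by
    intro x hx y hy hxy
    by_contra hne
    obtain ⟨g, hg, hfix⟩ := hA x hx
    apply hg
    apply hb
    rintro _ ⟨z, hz, rfl⟩
    by_cases hzx : z = x
    · subst hzx
      rw [hxy]
      exact hfix y (hAS hy) (fun h => hne h.symm)
    · exact hfix z hz hzx
  have hsub : f '' A ⊆ T := by
    rintro _ ⟨x, hx, rfl⟩
    by_contra hn
    obtain ⟨g, hg, hfix⟩ := hA x hx
    apply hg
    apply hT.prop
    intro t ht
    obtain ⟨z, hz, rfl⟩ := hTS ht
    apply hfix z hz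
    rintro rfl
    exact hn ht
  have hbdd : BddAbove (MinBaseSizes G Δ) := by
    refine ⟨Nat.card Δ, ?_⟩
    rintro _ ⟨U, -, rfl⟩
    exact Set.ncard_le_card U
  calc A.ncard = (f '' A).ncard := (Set.ncard_image_of_injOn hinj).symm
    _ ≤ T.ncard := Set.ncard_le_ncard hsub (Set.toFinite T)
    _ ≤ maxMinBaseSize G Δ := le_csSup hbdd ⟨T, hmin, rfl⟩

/-- **Lemma 3.1.** For the product action of `G × H` on `Δ × Λ`, every minimal
base has cardinality at most `B(G,Δ) + B(H,Λ)`. -/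
theorem maxMinBase_prod_le {G H Δ Λ : Type*} [Group G] [Group H]
    [Finite G] [Finite H] [Finite Δ] [Finite Λ] [MulAction G Δ] [MulAction H Λ]
    [FaithfulSMul G Δ] [FaithfulSMul H Λ]
    (S : Set (Δ × Λ)) (hS : IsMinBase (G × H) S) :
    S.ncard ≤ maxMinBaseSize G Δ + maxMinBaseSize H Λ := by
  have hsm : ∀ (p : G × H) (x : Δ × Λ), p • x = (p.1 • x.1, p.2 • x.2) := fun _ _ => rfl
  obtain ⟨hb, hm⟩ := hS
  have h1 : IsBase G (Prod.fst '' S) := by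
    intro g hg
    have := hb (g, 1) (fun x hx => by
      rw [hsm]; exact Prod.ext (hg _ ⟨x, hx, rfl⟩) (one_smul _ _))
    exact congrArg Prod.fst this
  have h2 : IsBase H (Prod.snd '' S) := by
    intro g hg
    have := hb (1, g) (fun x hx => by
      rw [hsm]; exact Prod.ext (one_smul _ _) (hg _ ⟨x, hx, rfl⟩))
    exact congrArg Prod.snd this
  let A : Set (Δ × Λ) := {x ∈ S | ∃ g : G, g ≠ 1 ∧ ∀ y ∈ S, y ≠ x → g • y.1 = y.1}
  let B : Set (Δ × Λ) := {x ∈ S | ∃ g : H, g ≠ 1 ∧ ∀ y ∈ S, y ≠ x → g • y.2 = y.2}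
  have hcov : S ⊆ A ∪ B := by
    intro x hx
    have hn := hm (S \ {x}) (Set.diff_singleton_ssubset.2 hx)
    unfold IsBase at hn
    push Not at hn
    obtain ⟨p, hp, hp1⟩ := hn
    by_cases hg : p.1 = 1
    · right
      refine ⟨hx, p.2, fun hh => hp1 (Prod.ext hg hh), fun y hy hyx => ?_⟩
      exact congrArg Prod.snd (hp y ⟨hy, hyx⟩)
    · left
      refine ⟨hx, p.1, hg, fun y hy hyx => ?_⟩
      exact congrArg Prod.fst (hp y ⟨hy, hyx⟩)
  calc S.ncard ≤ (A ∪ B).ncard := Set.ncard_le_ncard hcov (Set.toFinite _)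
    _ ≤ A.ncard + B.ncard := Set.ncard_union_le A B
    _ ≤ _ := Nat.add_le_add
      (maxMinBase_aux Prod.fst S A h1 (fun _ h => h.1) (fun _ h => h.2))
      (maxMinBase_aux Prod.snd S B h2 (fun _ h => h.1) (fun _ h => h.2))
end

section
/- Let G and H be finite groups acting faithfully on finite sets Δ and Λ respectively, and let {(δ_1,λ_1), …, (δ_k,λ_k)} be a minimal base (a set of k distinct pairs) for the product action of G × H on Δ × Λ. Then for every index j ∈ {1,…,k}, at least one of v^G_j = 1 or v^H_j = 1 holds; consequently n_G + n_H ≥ k. -/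
/-- `v^G_i = 1` for the family of points `δ : Fin k → Δ`: there is `g ∈ G` which
moves `δ i` and fixes `δ j` for every `j ≠ i`. -/
def MovesOnlyIndex (G : Type*) [Group G] {Δ : Type*} [MulAction G Δ] {k : ℕ}
    (δ : Fin k → Δ) (i : Fin k) : Prop :=
  ∃ g : G, g • δ i ≠ δ i ∧ ∀ j : Fin k, j ≠ i → g • δ j = δ j

/-- **Lemma 3.3(2).** If `{(δ 1, λ 1), …, (δ k, λ k)}` (a set of `k` distinct
pairs) is a minimal base for the product action of `G × H` on `Δ × Λ`, then for
every index `j` at least one of `v^G_j = 1`, `v^H_j = 1` holds; consequently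
`n_G + n_H ≥ k`. -/
theorem movesOnlyIndex_total {G H Δ Λ : Type*} [Group G] [Group H]
    [Finite G] [Finite H] [Finite Δ] [Finite Λ] [MulAction G Δ] [MulAction H Λ]
    [FaithfulSMul G Δ] [FaithfulSMul H Λ] {k : ℕ} (ω : Fin k → Δ × Λ)
    (hinj : Function.Injective ω) (hmin : IsMinBase (G × H) (Set.range ω)) :
    (∀ j : Fin k, MovesOnlyIndex G (fun t => (ω t).1) j ∨
        MovesOnlyIndex H (fun t => (ω t).2) j) ∧
      k ≤ {i : Fin k | MovesOnlyIndex G (fun t => (ω t).1) i}.ncard +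
        {i : Fin k | MovesOnlyIndex H (fun t => (ω t).2) i}.ncard := by
  have key : ∀ j : Fin k, MovesOnlyIndex G (fun t => (ω t).1) j ∨
        MovesOnlyIndex H (fun t => (ω t).2) j := by
    intro j
    have hss : ω '' {t | t ≠ j} ⊂ Set.range ω := by
      refine ⟨Set.image_subset_range _ _, fun h => ?_⟩
      obtain ⟨t, ht, hte⟩ := h ⟨j, rfl⟩
      exact ht (hinj hte)
    have hnb := hmin.2 _ hss
    unfold IsBase at hnb
    push Not at hnb
    obtain ⟨p, hp, hp1⟩ := hnb
    have h1 : ∀ t, t ≠ j → p.1 • (ω t).1 = (ω t).1 := fun t ht =>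
      congrArg Prod.fst (hp (ω t) ⟨t, ht, rfl⟩)
    have h2 : ∀ t, t ≠ j → p.2 • (ω t).2 = (ω t).2 := fun t ht =>
      congrArg Prod.snd (hp (ω t) ⟨t, ht, rfl⟩)
    by_cases hg : p.1 • (ω j).1 = (ω j).1
    · by_cases hh : p.2 • (ω j).2 = (ω j).2
      · refine absurd (hmin.1 p ?_) hp1
        rintro _ ⟨t, rfl⟩
        by_cases ht : t = j
        · subst ht
          exact Prod.ext hg hh
        · exact Prod.ext (h1 t ht) (h2 t ht)
      · exact Or.inr ⟨p.2, hh, h2⟩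
    · exact Or.inl ⟨p.1, hg, h1⟩
  refine ⟨key, ?_⟩
  refine le_trans ?_ (Set.ncard_union_le _ _)
  have hu : {i : Fin k | MovesOnlyIndex G (fun t => (ω t).1) i} ∪
        {i : Fin k | MovesOnlyIndex H (fun t => (ω t).2) i} = Set.univ :=
    Set.eq_univ_of_forall key
  rw [hu, Set.ncard_univ, Nat.card_eq_fintype_card, Fintype.card_fin]
end

section
/- Let G and H be finite groups acting faithfully on finite sets Δ and Λ respectively, and let {(δ_1,λ_1), …, (δ_k,λ_k)} be a minimal base (a set of k distinct pairs) for the product action of G × H on Δ × Λ. If k = B(G,Δ) + B(H,Λ), then n_G = B(G,Δ), n_H = B(H,Λ), and for every index i ∈ {1,…,k} exactly one of v^G_i and v^H_i equals 1 (i.e., v^G_i ≠ v^H_i). -/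
theorem ncard_moves_le {G Δ : Type*} [Group G] [Finite Δ] [MulAction G Δ] {k : ℕ}
    (δ : Fin k → Δ) (hb : IsBase G (Set.range δ)) :
    {i : Fin k | MovesOnlyIndex G δ i}.ncard ≤ maxMinBaseSize G Δ := by
  obtain ⟨T, hTle, hT⟩ := exists_minimal_le_of_wellFoundedLT
    (fun S : Set Δ => IsBase G S) (Set.range δ) hb
  have hTmin : IsMinBase G T := ⟨hT.prop, fun S hS hSb => hT.not_lt hSb hS⟩
  have hle : T.ncard ≤ maxMinBaseSize G Δ := by
    refine le_csSup ⟨Nat.card Δ, ?_⟩ ⟨T, hTmin, rfl⟩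
    rintro n ⟨S, -, rfl⟩
    exact Set.ncard_le_card S
  refine le_trans (Set.ncard_le_ncard_of_injOn δ ?_ ?_ T.toFinite) hle
  · rintro i ⟨g, hg, hfix⟩
    by_contra hi
    have : g = 1 := by
      refine hT.prop g fun x hx => ?_
      obtain ⟨j, rfl⟩ := hTle hx
      refine hfix j ?_
      rintro rfl
      exact hi hx
    subst this
    exact hg (one_smul _ _)
  · rintro i ⟨g, hg, hfix⟩ j _ hij
    by_contra hne
    exact hg (by rw [hij]; exact hfix j (Ne.symm hne))

/-- **Lemma 3.3(4)-(5).** Let `{(δ 1, λ 1), …, (δ k, λ k)}` (a set of `k`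
distinct pairs) be a minimal base for the product action of `G × H` on `Δ × Λ`.
If `k = B(G,Δ) + B(H,Λ)`, then `n_G = B(G,Δ)`, `n_H = B(H,Λ)`, and for every
index `i` exactly one of `v^G_i`, `v^H_i` equals `1`. -/
theorem movesOnlyIndex_of_card_eq_add {G H Δ Λ : Type*} [Group G] [Group H]
    [Finite G] [Finite H] [Finite Δ] [Finite Λ] [MulAction G Δ] [MulAction H Λ]
    [FaithfulSMul G Δ] [FaithfulSMul H Λ] {k : ℕ} (ω : Fin k → Δ × Λ)
    (hinj : Function.Injective ω) (hmin : IsMinBase (G × H) (Set.range ω))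
    (hk : k = maxMinBaseSize G Δ + maxMinBaseSize H Λ) :
    {i : Fin k | MovesOnlyIndex G (fun t => (ω t).1) i}.ncard = maxMinBaseSize G Δ ∧
    {i : Fin k | MovesOnlyIndex H (fun t => (ω t).2) i}.ncard = maxMinBaseSize H Λ ∧
    ∀ i : Fin k, MovesOnlyIndex G (fun t => (ω t).1) i ↔
      ¬ MovesOnlyIndex H (fun t => (ω t).2) i := by
  have hbG : IsBase G (Set.range fun t => (ω t).1) := by
    intro g hg
    have := hmin.1 (g, 1) (by
      rintro _ ⟨t, rfl⟩
      exact Prod.ext (hg _ ⟨t, rfl⟩) (one_smul H _))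
    exact congrArg Prod.fst this
  have hbH : IsBase H (Set.range fun t => (ω t).2) := by
    intro h hh
    have := hmin.1 (1, h) (by
      rintro _ ⟨t, rfl⟩
      exact Prod.ext (one_smul G _) (hh _ ⟨t, rfl⟩))
    exact congrArg Prod.snd this
  have h1 := ncard_moves_le _ hbG
  have h2 := ncard_moves_le _ hbH
  have hor : ∀ i, MovesOnlyIndex G (fun t => (ω t).1) i ∨
      MovesOnlyIndex H (fun t => (ω t).2) i := by
    intro i
    have hss : Set.range ω \ {ω i} ⊂ Set.range ω :=
      ⟨Set.diff_subset, fun h => (h ⟨i, rfl⟩).2 rfl⟩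
    have hn := hmin.2 _ hss
    simp only [IsBase, not_forall] at hn
    obtain ⟨p, hp, hp1⟩ := hn
    have hfix : ∀ j, j ≠ i → p • ω j = ω j := fun j hj =>
      hp _ ⟨⟨j, rfl⟩, fun h => hj (hinj h)⟩
    by_contra hcon
    rw [not_or] at hcon
    have a : p.1 • (ω i).1 = (ω i).1 := by
      by_contra ha
      exact hcon.1 ⟨p.1, ha, fun j hj => congrArg Prod.fst (hfix j hj)⟩
    have b : p.2 • (ω i).2 = (ω i).2 := by
      by_contra hb
      exact hcon.2 ⟨p.2, hb, fun j hj => congrArg Prod.snd (hfix j hj)⟩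
    refine hp1 (hmin.1 p ?_)
    rintro _ ⟨j, rfl⟩
    by_cases hj : j = i
    · subst hj
      exact Prod.ext a b
    · exact hfix j hj
  set A := {i : Fin k | MovesOnlyIndex G (fun t => (ω t).1) i} with hA
  set B := {i : Fin k | MovesOnlyIndex H (fun t => (ω t).2) i} with hB
  have hU : A ∪ B = Set.univ := Set.eq_univ_of_forall hor
  have hc := Set.ncard_union_add_ncard_inter A B
  rw [hU, Set.ncard_univ, Nat.card_fin] at hc
  have h0 : (A ∩ B).ncard = 0 := by omega
  rw [Set.ncard_eq_zero] at h0
  refine ⟨by omega, by omega, fun i => ⟨fun ha hb => ?_, fun hb => (hor i).resolve_right hb⟩⟩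
  have : i ∈ A ∩ B := ⟨ha, hb⟩
  rw [h0] at this
  exact this
end

section
/- Let G and H be finite groups acting faithfully on finite sets Δ and Λ respectively. Suppose G has a minimal base of cardinality a on Δ and H has a minimal base of cardinality b on Λ. Then for every integer k with max(a,b) ≤ k ≤ a + b − 2, the product action of G × H on Δ × Λ admits a minimal base of cardinality k. -/
theorem star_forest {a b k : ℕ} (hk₁ : max a b ≤ k) (hk₂ : k ≤ a + b - 2) :
    ∃ (f : Fin k → Fin a) (g : Fin k → Fin b), Function.Surjective f ∧ Function.Surjective g ∧
      ∀ t, (∀ s, f s = f t → s = t) ∨ (∀ s, g s = g t → s = t) := by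
  have hak : a ≤ k := le_trans (le_max_left _ _) hk₁
  have hbk : b ≤ k := le_trans (le_max_right _ _) hk₁
  obtain ⟨m, hm⟩ : ∃ m, m = a + b - 2 - k := ⟨_, rfl⟩
  refine ⟨fun t => ⟨if t.1 < m then t.1 else if t.1 < b - 1 then m else t.1 - (b - 1) + m + 1, ?_⟩,
    fun t => ⟨if t.1 < m then t.1 else if t.1 < b - 1 then t.1 + 1 else m, ?_⟩, ?_, ?_, ?_⟩
  · have := t.2
    split_ifs <;> omega
  · have := t.2
    split_ifs <;> omega
  · rintro ⟨i, hi⟩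
    simp only [Fin.mk.injEq]
    by_cases h1 : i < m
    · exact ⟨⟨i, by omega⟩, by simp [h1]⟩
    by_cases h2 : i = m
    · exact ⟨⟨m, by omega⟩, by dsimp only; split_ifs <;> omega⟩
    · exact ⟨⟨i - m - 1 + (b - 1), by omega⟩, by dsimp only; split_ifs <;> omega⟩
  · rintro ⟨i, hi⟩
    simp only [Fin.mk.injEq]
    by_cases h1 : i < m
    · exact ⟨⟨i, by omega⟩, by simp [h1]⟩
    by_cases h2 : i = m
    · exact ⟨⟨b - 1, by omega⟩, by dsimp only; split_ifs <;> omega⟩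
    · exact ⟨⟨i - 1, by omega⟩, by dsimp only; split_ifs <;> omega⟩
  · rintro ⟨t, ht⟩
    simp only [Fin.mk.injEq]
    by_cases h1 : m ≤ t ∧ t < b - 1
    · right
      rintro ⟨s, hs⟩ h
      simp only [Fin.mk.injEq] at h ⊢
      split_ifs at h <;> omega
    · left
      rintro ⟨s, hs⟩ h
      simp only [Fin.mk.injEq] at h ⊢
      split_ifs at h <;> omega

theorem IsMinBase.exists_private {G : Type*} [Group G] {Ω : Type*} [MulAction G Ω] {S : Set Ω}
    (hS : IsMinBase G S) {x : Ω} (hx : x ∈ S) :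
    ∃ g : G, g ≠ 1 ∧ ∀ y ∈ S, y ≠ x → g • y = y := by
  have h := hS.2 (S \ {x}) (Set.diff_singleton_ssubset.2 hx)
  unfold IsBase at h
  push Not at h
  obtain ⟨g, hg, h1⟩ := h
  exact ⟨g, h1, fun y hy hyx => hg y ⟨hy, hyx⟩⟩

/-- (Part of the proof of **Theorem 3.4**.) If `G` has a minimal base of
cardinality `a` on `Δ` and `H` has a minimal base of cardinality `b` on `Λ`,
then for every `k` with `max a b ≤ k ≤ a + b - 2` the product action of
`G × H` on `Δ × Λ` has a minimal base of cardinality `k`. -/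
theorem exists_minBase_prod_of_between {G H Δ Λ : Type*} [Group G] [Group H]
    [Finite G] [Finite H] [Finite Δ] [Finite Λ] [MulAction G Δ] [MulAction H Λ]
    [FaithfulSMul G Δ] [FaithfulSMul H Λ] {a b : ℕ}
    (ha : a ∈ MinBaseSizes G Δ) (hb : b ∈ MinBaseSizes H Λ) {k : ℕ}
    (hk₁ : max a b ≤ k) (hk₂ : k ≤ a + b - 2) :
    k ∈ MinBaseSizes (G × H) (Δ × Λ) := by
  obtain ⟨A, hA, hAc⟩ := ha
  obtain ⟨B, hB, hBc⟩ := hb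
  obtain ⟨f, g, hf, hg, hfg⟩ := star_forest hk₁ hk₂
  let eA : Fin a ≃ A := (Finite.equivFinOfCardEq (by simpa using hAc)).symm
  let eB : Fin b ≃ B := (Finite.equivFinOfCardEq (by simpa using hBc)).symm
  let p : Fin k → Δ × Λ := fun t => ((eA (f t)).1, (eB (g t)).1)
  have hp : Function.Injective p := by
    intro s t h
    have h1 : f s = f t := eA.injective (Subtype.ext (congrArg Prod.fst h))
    have h2 : g s = g t := eB.injective (Subtype.ext (congrArg Prod.snd h))
    rcases hfg t with h' | h'
    · exact h' s h1
    · exact h' s h2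
  refine ⟨Set.range p, ⟨?_, ?_⟩, ?_⟩
  · rintro ⟨u, v⟩ h
    have h' : ∀ t, u • (eA (f t)).1 = (eA (f t)).1 ∧ v • (eB (g t)).1 = (eB (g t)).1 := by
      intro t
      have := h (p t) ⟨t, rfl⟩
      exact ⟨congrArg Prod.fst this, congrArg Prod.snd this⟩
    refine Prod.ext (hA.1 u ?_) (hB.1 v ?_)
    · intro x hx
      obtain ⟨t, ht⟩ := hf (eA.symm ⟨x, hx⟩)
      simpa [ht] using (h' t).1
    · intro x hx
      obtain ⟨t, ht⟩ := hg (eB.symm ⟨x, hx⟩)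
      simpa [ht] using (h' t).2
  · intro T hT hTb
    obtain ⟨hTs, x, ⟨t, rfl⟩, hxT⟩ := Set.ssubset_iff_exists.1 hT
    rcases hfg t with h' | h'
    · obtain ⟨u, hu, hfix⟩ := hA.exists_private (eA (f t)).2
      refine hu (congrArg Prod.fst (hTb (u, 1) ?_))
      intro y hy
      obtain ⟨s, rfl⟩ := hTs hy
      refine Prod.ext (hfix _ (eA (f s)).2 ?_) (one_smul H _)
      intro h
      have := h' s (eA.injective (Subtype.ext h))
      exact hxT (this ▸ hy)
    · obtain ⟨u, hu, hfix⟩ := hB.exists_private (eB (g t)).2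
      refine hu (congrArg Prod.snd (hTb (1, u) ?_))
      intro y hy
      obtain ⟨s, rfl⟩ := hTs hy
      refine Prod.ext (one_smul G _) (hfix _ (eB (g s)).2 ?_)
      intro h
      have := h' s (eB.injective (Subtype.ext h))
      exact hxT (this ▸ hy)
  · rw [← Set.image_univ, Set.ncard_image_of_injective _ hp]
    simp
end

section
/- Let G be a nontrivial finite group acting faithfully on a finite set Δ, let n > 1 be an integer, and let S_n act naturally on {1,…,n}. Then, for the product action of G × S_n on Δ × {1,…,n}, one has B(G × S_n, Δ × {1,…,n}) ≤ B(G,Δ) + (n − 1) − 1 = B(G,Δ) + n − 2. -/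
theorem IsBase.mono_set {G : Type*} [Group G] {Ω : Type*} [MulAction G Ω] {S T : Set Ω}
    (hS : IsBase G S) (h : S ⊆ T) : IsBase G T :=
  fun g hg => hS g fun x hx => hg x (h hx)

theorem isBase_prod_iff {G H Δ Λ : Type*} [Group G] [Group H] [MulAction G Δ]
    [MulAction H Λ] (T : Set (Δ × Λ)) :
    IsBase (G × H) T ↔ IsBase G (Prod.fst '' T) ∧ IsBase H (Prod.snd '' T) := by
  have key : ∀ (g : G) (h : H) (x : Δ × Λ),
      (g, h) • x = x ↔ g • x.1 = x.1 ∧ h • x.2 = x.2 := by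
    intro g h x
    change ((g • x.1, h • x.2) : Δ × Λ) = x ↔ _
    rw [Prod.ext_iff]
  constructor
  · intro hT
    refine ⟨fun g hg => ?_, fun h hh => ?_⟩
    · have := hT (g, 1) fun x hx => (key _ _ _).2 ⟨hg _ ⟨x, hx, rfl⟩, one_smul _ _⟩
      exact congrArg Prod.fst this
    · have := hT (1, h) fun x hx => (key _ _ _).2 ⟨one_smul _ _, hh _ ⟨x, hx, rfl⟩⟩
      exact congrArg Prod.snd this
  · rintro ⟨h1, h2⟩ ⟨g, h⟩ hgh
    have e1 : g = 1 := h1 g (by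
      rintro _ ⟨x, hx, rfl⟩
      exact ((key _ _ _).1 (hgh x hx)).1)
    have e2 : h = 1 := h2 h (by
      rintro _ ⟨x, hx, rfl⟩
      exact ((key _ _ _).1 (hgh x hx)).2)
    rw [e1, e2]
    rfl

theorem exists_isMinBase_subset {G : Type*} [Group G] {Ω : Type*} [Finite Ω] [MulAction G Ω]
    {S : Set Ω} (hS : IsBase G S) : ∃ M ⊆ S, IsMinBase G M := by
  obtain ⟨M, hMS, hM⟩ := (Set.toFinite {T : Set Ω | IsBase G T}).exists_le_minimal hS
  refine ⟨M, hMS, hM.prop, fun T hT hb => ?_⟩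
  exact hT.2 (hM.le_of_le hb hT.1)

theorem IsMinBase.ncard_le_max {G : Type*} [Group G] {Ω : Type*} [Finite Ω] [MulAction G Ω]
    {S : Set Ω} (hS : IsMinBase G S) : S.ncard ≤ maxMinBaseSize G Ω := by
  refine le_csSup ⟨Nat.card Ω, ?_⟩ ⟨S, hS, rfl⟩
  rintro _ ⟨S, -, rfl⟩
  exact Set.ncard_le_card S

/-- A critical point is the only one in its fibre. -/
theorem critical_unique {G : Type*} [Group G] {Ω X : Type*} [MulAction G Ω] (f : X → Ω)
    {T : Set X} (hT : IsBase G (f '' T)) {t s : X} (hs : s ∈ T)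
    (hc : ¬ IsBase G (f '' (T \ {t}))) (h : f s = f t) : s = t := by
  by_contra hne
  refine hc (hT.mono_set ?_)
  rintro _ ⟨x, hx, rfl⟩
  by_cases hxt : x = t
  · exact ⟨s, ⟨hs, hne⟩, by rw [h, hxt]⟩
  · exact ⟨x, ⟨hx, hxt⟩, rfl⟩

theorem ncard_of_not_isBase_perm {n : ℕ} {S : Set (Fin n)}
    (hS : ¬ IsBase (Equiv.Perm (Fin n)) S) : S.ncard + 2 ≤ n := by
  unfold IsBase at hS
  push Not at hS
  obtain ⟨g, hg, hne⟩ := hS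
  have h2 := Equiv.Perm.two_le_card_support_of_ne_one hne
  have hsub : S ⊆ ((g.supportᶜ : Finset (Fin n)) : Set (Fin n)) := by
    intro x hx
    simpa using hg x hx
  have h1 := Set.ncard_le_ncard hsub
  rw [Set.ncard_coe_finset, Finset.card_compl, Fintype.card_fin] at h1
  have h3 := Finset.card_le_univ g.support
  rw [Fintype.card_fin] at h3
  omega

/-- **Lemma 3.6.** Let `G` be a nontrivial group acting faithfully on a finite
set `Δ` and let `n > 1`. For the product action of `G × Sym(n)` on
`Δ × {1,…,n}` (with `Sym(n)` acting naturally, so `B(Sym(n)) = n - 1`), one has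
`B(G × Sym(n), Δ × {1,…,n}) ≤ B(G,Δ) + (n - 1) - 1`. -/
theorem maxMinBase_prod_symmGroup_le {G Δ : Type*} [Group G] [Nontrivial G]
    [Finite G] [Finite Δ] [MulAction G Δ] [FaithfulSMul G Δ] (n : ℕ)
    (hn : 1 < n) :
    maxMinBaseSize (G × Equiv.Perm (Fin n)) (Δ × Fin n) ≤
      maxMinBaseSize G Δ + (n - 1) - 1 := by
  refine csSup_le' ?_
  rintro _ ⟨T, ⟨hT, hmin⟩, rfl⟩
  obtain ⟨b1, b2⟩ := (isBase_prod_iff T).1 hT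
  obtain ⟨M, hMT, hM⟩ := exists_isMinBase_subset b1
  have hMB := hM.ncard_le_max
  have hM1 : 1 ≤ M.ncard := by
    rw [Nat.one_le_iff_ne_zero, Ne, Set.ncard_eq_zero]
    rintro rfl
    obtain ⟨g, hg⟩ := exists_ne (1 : G)
    exact hg (hM.1 g (by simp))
  let A : Set (Δ × Fin n) := {t | t ∈ T ∧ ¬ IsBase G (Prod.fst '' (T \ {t}))}
  let C : Set (Δ × Fin n) :=
    {t | t ∈ T ∧ ¬ IsBase (Equiv.Perm (Fin n)) (Prod.snd '' (T \ {t}))}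
  have hAC : T ⊆ A ∪ C := by
    intro t ht
    have hb := hmin (T \ {t}) ⟨Set.diff_subset, fun h => (h ht).2 rfl⟩
    rw [isBase_prod_iff] at hb
    by_cases h : IsBase G (Prod.fst '' (T \ {t}))
    · exact Or.inr ⟨ht, fun h' => hb ⟨h, h'⟩⟩
    · exact Or.inl ⟨ht, h⟩
  have hA : A.ncard ≤ M.ncard := by
    refine Set.ncard_le_ncard_of_injOn Prod.fst ?_ ?_
    · intro t ht
      by_contra hn'
      refine ht.2 (hM.1.mono_set fun x hx => ?_)
      obtain ⟨y, hy, rfl⟩ := hMT hx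
      refine ⟨y, ⟨hy, ?_⟩, rfl⟩
      rintro rfl
      exact hn' hx
    · intro s hs t ht h
      exact critical_unique Prod.fst b1 hs.1 ht.2 h
  have hCinj : Set.InjOn Prod.snd C := fun s hs t ht h =>
    critical_unique Prod.snd b2 hs.1 ht.2 h
  have hTle : T.ncard ≤ A.ncard + C.ncard :=
    (Set.ncard_le_ncard hAC).trans (Set.ncard_union_le A C)
  rcases C.eq_empty_or_nonempty with hC | ⟨t, ht⟩
  · rw [hC, Set.ncard_empty] at hTle
    omega
  have h2 : (Prod.snd '' T).ncard + 1 ≤ n := by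
    have h3 := ncard_of_not_isBase_perm ht.2
    have h4 : Prod.snd '' T ⊆ insert t.2 (Prod.snd '' (T \ {t})) := by
      rintro _ ⟨x, hx, rfl⟩
      by_cases hxt : x = t
      · exact Or.inl (by rw [hxt])
      · exact Or.inr ⟨x, ⟨hx, hxt⟩, rfl⟩
    have h5 := (Set.ncard_le_ncard h4).trans (Set.ncard_insert_le _ _)
    omega
  have hCcard : (Prod.snd '' C).ncard = C.ncard := Set.ncard_image_of_injOn hCinj
  have hCT : C ⊆ T := fun x hx => hx.1
  by_cases hTC : T ⊆ C
  · have h6 := Set.ncard_le_ncard hTC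
    have h7 := Set.ncard_le_ncard (Set.image_mono (f := Prod.snd) hCT)
    omega
  · obtain ⟨s, hs, hsC⟩ := Set.not_subset.1 hTC
    have h8 : Prod.snd '' C ⊂ Prod.snd '' T := by
      refine ⟨Set.image_mono hCT, fun h => ?_⟩
      obtain ⟨c, hc, hcs⟩ := h ⟨s, hs, rfl⟩
      have := critical_unique Prod.snd b2 hs hc.2 hcs.symm
      exact hsC (this ▸ hc)
    have h9 := Set.ncard_lt_ncard h8
    omega
end

section
/- Let n, m ≥ 3 be integers, and consider the product action of S_n × S_m on {1,…,n} × {1,…,m}, where S_n and S_m act naturally on {1,…,n} and {1,…,m}. Then B(S_n × S_m, {1,…,n} × {1,…,m}) = (n − 1) + (m − 1) − 2 = n + m − 4. -/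
theorem isBase_iff_aux {n m : ℕ} (S : Set (Fin n × Fin m)) :
    IsBase (Equiv.Perm (Fin n) × Equiv.Perm (Fin m)) S ↔
      (∀ i i', (∀ x ∈ S, x.1 ≠ i) → (∀ x ∈ S, x.1 ≠ i') → i = i') ∧
      (∀ j j', (∀ x ∈ S, x.2 ≠ j) → (∀ x ∈ S, x.2 ≠ j') → j = j') := by
  constructor
  · intro h
    refine ⟨fun i i' hi hi' => ?_, fun j j' hj hj' => ?_⟩
    · have h1 := h (Equiv.swap i i', 1) (fun x hx => by
        show (Equiv.swap i i' x.1, x.2) = x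
        rw [Equiv.swap_apply_of_ne_of_ne (hi x hx) (hi' x hx)])
      have h2 : Equiv.swap i i' = 1 := congrArg Prod.fst h1
      exact Equiv.swap_eq_one_iff.mp h2
    · have h1 := h (1, Equiv.swap j j') (fun x hx => by
        show (x.1, Equiv.swap j j' x.2) = x
        rw [Equiv.swap_apply_of_ne_of_ne (hj x hx) (hj' x hx)])
      have h2 : Equiv.swap j j' = 1 := congrArg Prod.snd h1
      exact Equiv.swap_eq_one_iff.mp h2
  · rintro ⟨h1, h2⟩ ⟨σ, τ⟩ hg
    have hσ : ∀ x ∈ S, σ x.1 = x.1 := fun x hx => congrArg Prod.fst (hg x hx)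
    have hτ : ∀ x ∈ S, τ x.2 = x.2 := fun x hx => congrArg Prod.snd (hg x hx)
    have e1 : σ = 1 := by
      ext1 i
      by_contra hne
      have hne : σ i ≠ i := hne
      refine hne (h1 (σ i) i ?_ ?_)
      · intro x hx he
        have := hσ x hx
        rw [he] at this
        exact hne (σ.injective this)
      · intro x hx he
        have := hσ x hx
        rw [he] at this
        exact hne this
    have e2 : τ = 1 := by
      ext1 i
      by_contra hne
      have hne : τ i ≠ i := hne
      refine hne (h2 (τ i) i ?_ ?_)
      · intro x hx he
        have := hτ x hx
        rw [he] at this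
        exact hne (τ.injective this)
      · intro x hx he
        have := hτ x hx
        rw [he] at this
        exact hne this
    rw [e1, e2]; rfl

/-- Edges alone in their fibre inject into the index set minus a set of excluded values. -/
theorem card_aux {α : Type*} {k : ℕ} (A : Finset α) (f : α → Fin k) (E : Finset (Fin k))
    (hinj : ∀ x ∈ A, ∀ y ∈ A, f x = f y → x = y) (hE : ∀ x ∈ A, f x ∉ E) :
    A.card + E.card ≤ k := by
  classical
  have h1 : (A.image f).card = A.card := Finset.card_image_of_injOn (fun x hx y hy h => hinj x hx y hy h)
  have h2 : Disjoint (A.image f) E := by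
    rw [Finset.disjoint_left]
    intro a ha
    obtain ⟨x, hx, rfl⟩ := Finset.mem_image.mp ha
    exact hE x hx
  rw [← h1, ← Finset.card_union_of_disjoint h2]
  simpa using Finset.card_le_univ (A.image f ∪ E)

theorem upper_aux {n m : ℕ} (hn : 3 ≤ n) (hm : 3 ≤ m) (S : Finset (Fin n × Fin m))
    (hS : ∀ x ∈ S, ((∀ y ∈ S, y.1 = x.1 → y = x) ∧ ∃ i, ∀ y ∈ S, y.1 ≠ i) ∨
      ((∀ y ∈ S, y.2 = x.2 → y = x) ∧ ∃ j, ∀ y ∈ S, y.2 ≠ j)) :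
    S.card ≤ n + m - 4 := by
  classical
  by_cases hA : ∀ x ∈ S, (∀ y ∈ S, y.1 = x.1 → y = x) ∧ ∃ i, ∀ y ∈ S, y.1 ≠ i
  · rcases S.eq_empty_or_nonempty with rfl | ⟨x, hx⟩
    · simp
    · obtain ⟨_, i, hi⟩ := hA x hx
      have := card_aux S Prod.fst {i} (fun x hx y hy h => (hA y hy).1 x hx h)
        (fun x hx => by simpa using hi x hx)
      simp at this
      omega
  by_cases hB : ∀ x ∈ S, (∀ y ∈ S, y.2 = x.2 → y = x) ∧ ∃ i, ∀ y ∈ S, y.2 ≠ i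
  · rcases S.eq_empty_or_nonempty with rfl | ⟨x, hx⟩
    · simp
    · obtain ⟨_, i, hi⟩ := hB x hx
      have := card_aux S Prod.snd {i} (fun x hx y hy h => (hB y hy).1 x hx h)
        (fun x hx => by simpa using hi x hx)
      simp at this
      omega
  push Not at hA hB
  obtain ⟨e, he, hea⟩ := hA
  obtain ⟨f, hf, hfb⟩ := hB
  have he2 : ∃ j, ∀ y ∈ S, y.2 ≠ j := by
    rcases hS e he with h | h
    · obtain ⟨h1, i, hi⟩ := h
      obtain ⟨y, hy, h⟩ := hea h1 i
      exact absurd h (hi y hy)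
    · exact h.2
  have hf2 : ∃ j, ∀ y ∈ S, y.1 ≠ j := by
    rcases hS f hf with h | h
    · exact h.2
    · obtain ⟨h1, i, hi⟩ := h
      obtain ⟨y, hy, h⟩ := hfb h1 i
      exact absurd h (hi y hy)
  obtain ⟨j, hj⟩ := he2
  obtain ⟨i, hi⟩ := hf2
  have he3 : ¬ ∀ y ∈ S, y.1 = e.1 → y = e := fun h => by
    obtain ⟨y, hy, h⟩ := hea h i
    exact hi y hy h
  have hf3 : ¬ ∀ y ∈ S, y.2 = f.2 → y = f := fun h => by
    obtain ⟨y, hy, h⟩ := hfb h j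
    exact hj y hy h
  set A := S.filter (fun x => ∀ y ∈ S, y.1 = x.1 → y = x) with hAdef
  set B := S.filter (fun x => ¬ ∀ y ∈ S, y.1 = x.1 → y = x) with hBdef
  have hcard : A.card + B.card = S.card := Finset.card_filter_add_card_filter_not _
  have hB' : ∀ x ∈ B, x ∈ S ∧ ∀ y ∈ S, y.2 = x.2 → y = x := by
    intro x hx
    obtain ⟨hx1, hx2⟩ := Finset.mem_filter.mp hx
    refine ⟨hx1, ?_⟩
    rcases hS x hx1 with h | h
    · exact absurd h.1 hx2
    · exact h.1
  have cA := card_aux A Prod.fst {i, e.1}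
    (fun x hx y hy h => (Finset.mem_filter.mp hy).2 x (Finset.mem_filter.mp hx).1 h)
    (fun x hx => by
      obtain ⟨h1, h2⟩ := Finset.mem_filter.mp hx
      simp only [Finset.mem_insert, Finset.mem_singleton, not_or]
      refine ⟨hi x h1, fun h => he3 ?_⟩
      have := h2 e he h.symm
      rw [this]; exact h2)
  have cB := card_aux B Prod.snd {j, f.2}
    (fun x hx y hy h => (hB' y hy).2 x (hB' x hx).1 h)
    (fun x hx => by
      obtain ⟨h1, h2⟩ := hB' x hx
      simp only [Finset.mem_insert, Finset.mem_singleton, not_or]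
      refine ⟨hj x h1, fun h => hf3 ?_⟩
      have := h2 f hf h.symm
      rw [this]; exact h2)
  rw [Finset.card_pair (hi e he).symm] at cA
  rw [Finset.card_pair (hj f hf).symm] at cB
  omega

theorem upper_aux2 {n m : ℕ} (hn : 3 ≤ n) (hm : 3 ≤ m) (S : Set (Fin n × Fin m))
    (hS : IsMinBase (Equiv.Perm (Fin n) × Equiv.Perm (Fin m)) S) : S.ncard ≤ n + m - 4 := by
  classical
  rw [Set.ncard_eq_toFinset_card']
  apply upper_aux hn hm
  simp only [Set.mem_toFinset]
  intro x hx
  obtain ⟨hb, hmin⟩ := hS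
  have h := hmin (S \ {x}) ⟨Set.sdiff_subset, fun h => (h hx).2 rfl⟩
  rw [isBase_iff_aux] at h hb
  by_contra hcon
  push Not at hcon
  obtain ⟨c1, c2⟩ := hcon
  apply h
  constructor
  · intro i i' hi hi'
    by_contra hne
    have key : ∀ k, (∀ y ∈ S \ {x}, y.1 ≠ k) → k = x.1 ∨ ∀ y ∈ S, y.1 ≠ k := by
      intro k hk
      by_cases hkx : k = x.1
      · exact Or.inl hkx
      · refine Or.inr fun y hy hyk => ?_
        by_cases hyx : y = x
        · subst hyx; exact hkx hyk.symm
        · exact hk y ⟨hy, hyx⟩ hyk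
    have fin : ∀ k k', k = x.1 → (∀ y ∈ S \ {x}, y.1 ≠ k) → (∀ y ∈ S, y.1 ≠ k') → False := by
      intro k k' hk hk1 hk2
      obtain ⟨y, hy, hyk⟩ := c1 (fun y hy hyx => by
        by_contra hyne
        exact hk1 y ⟨hy, hyne⟩ (hyx.trans hk.symm)) k'
      exact hk2 y hy hyk
    rcases key i hi with a | a <;> rcases key i' hi' with b | b
    · exact hne (a.trans b.symm)
    · exact fin i i' a hi b
    · exact fin i' i b hi' a
    · exact hne (hb.1 i i' a b)
  · intro i i' hi hi'
    by_contra hne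
    have key : ∀ k, (∀ y ∈ S \ {x}, y.2 ≠ k) → k = x.2 ∨ ∀ y ∈ S, y.2 ≠ k := by
      intro k hk
      by_cases hkx : k = x.2
      · exact Or.inl hkx
      · refine Or.inr fun y hy hyk => ?_
        by_cases hyx : y = x
        · subst hyx; exact hkx hyk.symm
        · exact hk y ⟨hy, hyx⟩ hyk
    have fin : ∀ k k', k = x.2 → (∀ y ∈ S \ {x}, y.2 ≠ k) → (∀ y ∈ S, y.2 ≠ k') → False := by
      intro k k' hk hk1 hk2
      obtain ⟨y, hy, hyk⟩ := c2 (fun y hy hyx => by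
        by_contra hyne
        exact hk1 y ⟨hy, hyne⟩ (hyx.trans hk.symm)) k'
      exact hk2 y hy hyk
    rcases key i hi with a | a <;> rcases key i' hi' with b | b
    · exact hne (a.trans b.symm)
    · exact fin i i' a hi b
    · exact fin i' i b hi' a
    · exact hne (hb.2 i i' a b)

theorem lower_aux (a b : ℕ) :
    ∃ S : Set (Fin (a + 3) × Fin (b + 3)),
      IsMinBase (Equiv.Perm (Fin (a + 3)) × Equiv.Perm (Fin (b + 3))) S ∧
      S.ncard = (a + 1) + (b + 1) := by
  classical
  let f : Fin (a + 1) ⊕ Fin (b + 1) → Fin (a + 3) × Fin (b + 3) :=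
    Sum.elim (fun i => (⟨i + 1, by omega⟩, ⟨0, by omega⟩)) (fun j => (⟨0, by omega⟩, ⟨j + 1, by omega⟩))
  have hf : Function.Injective f := by
    rintro (i | i) (j | j) h
    · have := congrArg (fun x => x.1.val) h
      simp only [f, Sum.elim_inl] at this
      exact congrArg Sum.inl (Fin.ext (by omega))
    · have := congrArg (fun x => x.1.val) h
      simp only [f, Sum.elim_inl, Sum.elim_inr] at this
      omega
    · have := congrArg (fun x => x.1.val) h
      simp only [f, Sum.elim_inl, Sum.elim_inr] at this
      omega
    · have := congrArg (fun x => x.2.val) h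
      simp only [f, Sum.elim_inr] at this
      exact congrArg Sum.inr (Fin.ext (by omega))
  have hmem : ∀ x : Fin (a + 3) × Fin (b + 3), x ∈ Set.range f ↔
      ((x.1.val ≠ 0 ∧ x.1.val ≠ a + 2 ∧ x.2.val = 0) ∨
        (x.2.val ≠ 0 ∧ x.2.val ≠ b + 2 ∧ x.1.val = 0)) := by
    rintro ⟨⟨i, hi⟩, ⟨j, hj⟩⟩
    constructor
    · rintro ⟨(k | k), hk⟩
      · simp [f, Fin.ext_iff] at hk
        have := k.2
        left; simp only; omega
      · simp [f, Fin.ext_iff] at hk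
        have := k.2
        right; simp only; omega
    · rintro (⟨h1, h2, h3⟩ | ⟨h1, h2, h3⟩)
      · simp only at h1 h2 h3
        refine ⟨Sum.inl ⟨i - 1, by omega⟩, ?_⟩
        simp [f, Fin.ext_iff]; omega
      · simp only at h1 h2 h3
        refine ⟨Sum.inr ⟨j - 1, by omega⟩, ?_⟩
        simp [f, Fin.ext_iff]; omega
  refine ⟨Set.range f, ⟨?_, ?_⟩, ?_⟩
  · rw [isBase_iff_aux]
    constructor
    · have key : ∀ i : Fin (a + 3), (∀ x ∈ Set.range f, x.1 ≠ i) → i.val = a + 2 := by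
        intro i hi
        by_contra hne
        by_cases h0 : i.val = 0
        · exact hi (i, ⟨1, by omega⟩) ((hmem _).2 (Or.inr ⟨by simp, by simp, h0⟩)) rfl
        · exact hi (i, ⟨0, by omega⟩) ((hmem _).2 (Or.inl ⟨h0, hne, rfl⟩)) rfl
      intro i i' hi hi'
      exact Fin.ext ((key i hi).trans (key i' hi').symm)
    · have key : ∀ i : Fin (b + 3), (∀ x ∈ Set.range f, x.2 ≠ i) → i.val = b + 2 := by
        intro i hi
        by_contra hne
        by_cases h0 : i.val = 0
        · exact hi (⟨1, by omega⟩, i) ((hmem _).2 (Or.inl ⟨by simp, by simp, h0⟩)) rfl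
        · exact hi (⟨0, by omega⟩, i) ((hmem _).2 (Or.inr ⟨h0, hne, rfl⟩)) rfl
      intro i i' hi hi'
      exact Fin.ext ((key i hi).trans (key i' hi').symm)
  · intro T hT hb
    rw [isBase_iff_aux] at hb
    obtain ⟨hsub, hns⟩ := hT
    obtain ⟨x, hx, hxT⟩ := Set.not_subset.mp hns
    rcases (hmem x).1 hx with ⟨h1, h2, h3⟩ | ⟨h1, h2, h3⟩
    · have := hb.1 x.1 ⟨a + 2, by omega⟩
        (fun y hy hyx => by
          apply hxT
          have hy2 := (hmem y).1 (hsub hy)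
          have : y = x := Prod.ext hyx (Fin.ext (by rw [hyx] at hy2; omega))
          exact this ▸ hy)
        (fun y hy hyx => by
          have hy2 := (hmem y).1 (hsub hy)
          have := congrArg Fin.val hyx
          simp only at this
          omega)
      exact h2 (congrArg Fin.val this)
    · have := hb.2 x.2 ⟨b + 2, by omega⟩
        (fun y hy hyx => by
          apply hxT
          have hy2 := (hmem y).1 (hsub hy)
          have : y = x := Prod.ext (Fin.ext (by rw [hyx] at hy2; omega)) hyx
          exact this ▸ hy)
        (fun y hy hyx => by
          have hy2 := (hmem y).1 (hsub hy)
          have := congrArg Fin.val hyx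
          simp only at this
          omega)
      exact h2 (congrArg Fin.val this)
  · rw [← Set.image_univ, Set.ncard_image_of_injective _ hf, Set.ncard_univ]
    simp

/-- For `n, m ≥ 3`, the product action of `Sym(n) × Sym(m)` on
`{1,…,n} × {1,…,m}` satisfies `B(Sym(n) × Sym(m)) = (n-1) + (m-1) - 2 = n + m - 4`. -/
theorem maxMinBase_symm_prod_symm (n m : ℕ) (hn : 3 ≤ n) (hm : 3 ≤ m) :
    maxMinBaseSize (Equiv.Perm (Fin n) × Equiv.Perm (Fin m)) (Fin n × Fin m) =
      n + m - 4 := by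
  refine IsGreatest.csSup_eq ⟨?_, ?_⟩
  · obtain ⟨a, rfl⟩ := Nat.exists_eq_add_of_le' hn
    obtain ⟨b, rfl⟩ := Nat.exists_eq_add_of_le' hm
    obtain ⟨S, hS, hc⟩ := lower_aux a b
    exact ⟨S, hS, by omega⟩
  · rintro k ⟨S, hS, rfl⟩
    exact upper_aux2 hn hm S hS
end

section
/- Let t ≥ 2 and let n_1, …, n_t be integers with n_i ≥ 3 for all i. Consider the product action of S_{n_1} × ⋯ × S_{n_t} on {1,…,n_1} × ⋯ × {1,…,n_t}, where each S_{n_i} acts naturally on {1,…,n_i}. Then M(S_{n_1} × ⋯ × S_{n_t}, {1,…,n_1} × ⋯ × {1,…,n_t}) = {max_{i}(n_i − 1), max_i(n_i − 1) + 1, …, (∑_{i=1}^{t}(n_i − 1)) − t}. -/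
theorem isBase_pi_iff {t : ℕ} (n : Fin t → ℕ) (S : Set (∀ i, Fin (n i))) :
    IsBase (∀ i, Equiv.Perm (Fin (n i))) S ↔
      ∀ i, ∀ a b : Fin (n i), (∀ x ∈ S, x i ≠ a) → (∀ x ∈ S, x i ≠ b) → a = b := by
  constructor
  · intro h i a b ha hb
    have h1 := h (Pi.mulSingle i (Equiv.swap a b)) (by
      intro x hx
      funext j
      change (Pi.mulSingle i (Equiv.swap a b) : ∀ i, Equiv.Perm (Fin (n i))) j (x j) = x j
      by_cases hj : j = i
      · subst hj
        rw [Pi.mulSingle_eq_same]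
        exact Equiv.swap_apply_of_ne_of_ne (ha x hx) (hb x hx)
      · rw [Pi.mulSingle_eq_of_ne hj]
        rfl)
    have h2 := congrFun h1 i
    rw [Pi.mulSingle_eq_same] at h2
    simpa using h2
  · intro h g hg
    funext i
    ext1 a
    by_contra hne
    have hne' : g i a ≠ a := hne
    have key : ∀ c, g i c ≠ c → ∀ x ∈ S, x i ≠ c := by
      intro c hc x hx hxc
      have h3 : g i (x i) = x i := congrFun (hg x hx) i
      rw [hxc] at h3
      exact hc h3
    have hga : g i (g i a) ≠ g i a := fun h4 => hne' ((g i).injective h4)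
    exact hne' (h i (g i a) a (key _ hga) (key _ hne'))

theorem exists_coord {m N : ℕ} (hN : 3 ≤ N) (hm : N - 1 ≤ m) (C : Finset (Fin m))
    (hC : C.card ≤ N - 2) :
    ∃ g : Fin m → Fin N, ∃ w : Fin N, (∀ v, v ≠ w → ∃ k, g k = v) ∧ (∀ k, g k ≠ w) ∧
      ∀ k ∈ C, ∀ l, g l = g k → l = k := by
  obtain ⟨A, hCA, -, hA⟩ := Finset.exists_subsuperset_card_eq (Finset.subset_univ C) hC
    (by simp; omega)
  let e := A.equivFinOfCardEq hA
  obtain ⟨z, hz⟩ : ∃ z, z ∉ A := by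
    by_contra! hall
    have : A = Finset.univ := Finset.eq_univ_iff_forall.2 hall
    rw [this] at hA
    simp at hA
    omega
  refine ⟨fun k => if h : k ∈ A then ⟨e ⟨k, h⟩, by omega⟩ else ⟨N - 2, by omega⟩,
    ⟨N - 1, by omega⟩, ?_, ?_, ?_⟩
  · intro v hv
    have hv' : (v : ℕ) ≠ N - 1 := fun h => hv (Fin.ext h)
    by_cases h2 : (v : ℕ) < N - 2
    · refine ⟨e.symm ⟨v, h2⟩, ?_⟩
      simp
    · refine ⟨z, ?_⟩
      simp only [hz, dite_false]
      ext
      simp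
      omega
  · intro k
    by_cases hk : k ∈ A
    · simp only [hk, dite_true, ne_eq, Fin.mk.injEq]
      omega
    · simp only [hk, dite_false, ne_eq, Fin.mk.injEq]
      omega
  · intro k hk l hl
    have hkA := hCA hk
    by_cases hlA : l ∈ A
    · simp only [hkA, hlA, dite_true, Fin.mk.injEq] at hl
      have := e.injective (Fin.ext hl)
      simpa using this
    · simp only [hkA, hlA, dite_true, dite_false, Fin.mk.injEq] at hl
      omega

theorem sum_shift {t : ℕ} (n : Fin t → ℕ) (hn : ∀ i, 3 ≤ n i) :
    (∑ i, (n i - 1)) - t = ∑ i, (n i - 2) := by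
  have : ∑ i, (n i - 1) = ∑ i, ((n i - 2) + 1) :=
    Finset.sum_congr rfl fun i _ => by have := hn i; omega
  rw [this, Finset.sum_add_distrib]
  simp

theorem le_sum_shift {t : ℕ} (ht : 2 ≤ t) (n : Fin t → ℕ) (hn : ∀ i, 3 ≤ n i) (i : Fin t) :
    n i - 1 ≤ ∑ i, (n i - 2) := by
  have : Nontrivial (Fin t) := Fin.nontrivial_iff_two_le.2 ht
  obtain ⟨j, hj⟩ := exists_ne i
  rw [← Finset.add_sum_erase _ _ (Finset.mem_univ i)]
  have h := Finset.single_le_sum (f := fun i => n i - 2) (fun _ _ => Nat.zero_le _)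
    (Finset.mem_erase.2 ⟨hj, Finset.mem_univ j⟩)
  have := hn i
  have := hn j
  omega

theorem minBase_upper {t : ℕ} (ht : 2 ≤ t) (n : Fin t → ℕ) (hn : ∀ i, 3 ≤ n i)
    (S : Finset (∀ i, Fin (n i)))
    (h : ∀ x ∈ S, ∃ i, (∀ y ∈ S, y i = x i → y = x) ∧ ∃ v, ∀ y ∈ S, y i ≠ v) :
    S.card ≤ ∑ i, (n i - 2) := by
  classical
  have : Nonempty (Fin t) := ⟨⟨0, by omega⟩⟩
  choose! f hf using h
  have hinj : ∀ i, Set.InjOn (fun x : ∀ i, Fin (n i) => x i) (S.filter (f · = i)) := by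
    intro i x hx y hy hxy
    simp only [Finset.coe_filter, Set.mem_ofPred_eq] at hx hy
    obtain ⟨hy1, rfl⟩ := hy
    exact (hf y hy1).1 x hx.1 hxy
  by_cases hex : ∃ i, n i - 1 ≤ (S.filter (f · = i)).card
  · obtain ⟨i, hi⟩ := hex
    have hni := hn i
    obtain ⟨x0, hx0⟩ : (S.filter (f · = i)).Nonempty := Finset.card_pos.1 (by omega)
    rw [Finset.mem_filter] at hx0
    have hvex := (hf x0 hx0.1).2
    rw [hx0.2] at hvex
    obtain ⟨v, hv⟩ := hvex
    have hsub : (S.filter (f · = i)).image (fun x => x i) ⊆ Finset.univ.erase v := by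
      intro a ha
      simp only [Finset.mem_image, Finset.mem_filter] at ha
      obtain ⟨y, hy, rfl⟩ := ha
      exact Finset.mem_erase.2 ⟨hv y hy.1, Finset.mem_univ _⟩
    have heq := Finset.eq_of_subset_of_card_le hsub (by
      rw [Finset.card_image_of_injOn (hinj i)]
      simpa using hi)
    have hS : S ⊆ S.filter (f · = i) := by
      intro y hy
      have : y i ∈ Finset.univ.erase v := Finset.mem_erase.2 ⟨hv y hy, Finset.mem_univ _⟩
      rw [← heq] at this
      simp only [Finset.mem_image, Finset.mem_filter] at this
      obtain ⟨x, ⟨hx, hxi⟩, hxy⟩ := this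
      subst hxi
      rw [(hf x hx).1 y hy hxy.symm]
      simp [hx]
    calc S.card ≤ (S.filter (f · = i)).card := Finset.card_le_card hS
      _ = ((S.filter (f · = i)).image (fun x => x i)).card :=
        (Finset.card_image_of_injOn (hinj i)).symm
      _ ≤ (Finset.univ.erase v).card := Finset.card_le_card hsub
      _ = n i - 1 := by simp
      _ ≤ _ := le_sum_shift ht n hn i
  · push Not at hex
    rw [Finset.card_eq_sum_card_fiberwise (f := f) (t := Finset.univ) (by intro x _; simp)]
    refine Finset.sum_le_sum fun i _ => ?_
    have := hex i
    omega

theorem minBase_construct {t : ℕ} (n : Fin t → ℕ) (hn : ∀ i, 3 ≤ n i) (m : ℕ)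
    (h1 : ∀ i, n i - 1 ≤ m) (h2 : m ≤ ∑ i, (n i - 2)) :
    m ∈ MinBaseSizes (∀ i, Equiv.Perm (Fin (n i))) (∀ i, Fin (n i)) := by
  classical
  obtain ⟨e⟩ : Nonempty (Fin m ↪ (Σ i, Fin (n i - 2))) :=
    Function.Embedding.nonempty_of_card_le (by simpa using h2)
  have hC : ∀ i, (Finset.univ.filter fun k => (e k).1 = i).card ≤ n i - 2 := by
    intro i
    calc (Finset.univ.filter fun k => (e k).1 = i).card
        = ((Finset.univ.filter fun k => (e k).1 = i).map e).card := by simp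
      _ ≤ ((Finset.univ : Finset (Fin (n i - 2))).image
            (fun a => (⟨i, a⟩ : Σ i, Fin (n i - 2)))).card := by
          apply Finset.card_le_card
          intro p hp
          simp only [Finset.mem_map, Finset.mem_filter, Finset.mem_univ, true_and] at hp
          obtain ⟨k, rfl, rfl⟩ := hp
          exact Finset.mem_image.2 ⟨(e k).2, Finset.mem_univ _, rfl⟩
      _ ≤ _ := Finset.card_image_le.trans (by simp)
  choose g w hg1 hg2 hg3 using fun i => exists_coord (hn i) (h1 i) _ (hC i)
  let p : Fin m → ∀ i, Fin (n i) := fun k i => g i k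
  have hu : ∀ k l, g (e k).1 l = g (e k).1 k → l = k := fun k l =>
    hg3 (e k).1 k (by simp) l
  have hp : Function.Injective p := fun l k h => hu k l (congrFun h _)
  refine ⟨Set.range p, ⟨?_, ?_⟩, ?_⟩
  · rw [isBase_pi_iff]
    have key : ∀ i (a : Fin (n i)), (∀ x ∈ Set.range p, x i ≠ a) → a = w i := by
      intro i a ha
      by_contra hne
      obtain ⟨k, hk⟩ := hg1 i a hne
      exact ha (p k) ⟨k, rfl⟩ hk
    intro i a b ha hb
    rw [key i a ha, key i b hb]
  · intro T hT hB
    rw [isBase_pi_iff] at hB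
    obtain ⟨hTs, hTn⟩ := hT
    obtain ⟨x, ⟨k, rfl⟩, hx⟩ := Set.not_subset.1 hTn
    refine hg2 (e k).1 k (hB (e k).1 _ _ ?_ ?_)
    · intro y hy hyk
      obtain ⟨l, rfl⟩ := hTs hy
      exact hx (hu k l hyk ▸ hy)
    · intro y hy
      obtain ⟨l, rfl⟩ := hTs hy
      exact hg2 _ l
  · rw [← Set.image_univ, Set.ncard_image_of_injective _ hp]
    simp

/-- **Proposition 3.5.** Let `t ≥ 2` and `n 0, …, n (t-1) ≥ 3`. For the
componentwise product action of `Sym(n 0) × ⋯ × Sym(n (t-1))` on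
`{1,…,n 0} × ⋯ × {1,…,n (t-1)}`, the set of cardinalities of minimal bases is
exactly the interval `{max_i (n i - 1), …, (∑ i, (n i - 1)) - t}`. -/
theorem minBaseSizes_pi_symm (t : ℕ) (ht : 2 ≤ t) (n : Fin t → ℕ)
    (hn : ∀ i, 3 ≤ n i) :
    MinBaseSizes (∀ i, Equiv.Perm (Fin (n i))) (∀ i, Fin (n i)) =
      Set.Icc (Finset.univ.sup fun i => n i - 1) ((∑ i, (n i - 1)) - t) := by
  classical
  rw [sum_shift n hn]
  ext m
  rw [Set.mem_Icc, Finset.sup_le_iff]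
  constructor
  · rintro ⟨S0, ⟨hB, hmin⟩, rfl⟩
    obtain ⟨S, rfl⟩ := S0.toFinite.exists_finset_coe
    rw [isBase_pi_iff] at hB
    rw [Set.ncard_coe_finset]
    constructor
    · intro i _
      have hc : (Finset.univ \ S.image (fun x => x i)).card ≤ 1 := by
        rw [Finset.card_le_one]
        intro a ha b hb
        simp only [Finset.mem_sdiff, Finset.mem_univ, true_and, Finset.mem_image, not_exists,
          not_and] at ha hb
        exact hB i a b ha hb
      have h1 := Finset.le_card_sdiff (S.image (fun x => x i)) Finset.univ
      have h2 := Finset.card_image_le (s := S) (f := fun x => x i)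
      simp only [Finset.card_univ, Fintype.card_fin] at h1
      omega
    · apply minBase_upper ht n hn S
      intro x hx
      have hT := hmin (↑S \ {x}) (Set.diff_singleton_ssubset.2 hx)
      rw [isBase_pi_iff] at hT
      push Not at hT
      obtain ⟨i, a, b, ha, hb, hab⟩ := hT
      refine ⟨i, ?_⟩
      have hy' : ∀ c, (∀ y ∈ (S : Set (∀ i, Fin (n i))) \ {x}, y i ≠ c) → x i ≠ c →
          ∀ y ∈ S, y i ≠ c := by
        intro c hc hxc y hy
        by_cases hyx : y = x
        · rwa [hyx]
        · exact hc y ⟨hy, hyx⟩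
      have main : ∀ a b, (∀ y ∈ (S : Set (∀ i, Fin (n i))) \ {x}, y i ≠ a) →
          (∀ y ∈ (S : Set (∀ i, Fin (n i))) \ {x}, y i ≠ b) → a ≠ b → x i = a →
          (∀ y ∈ S, y i = x i → y = x) ∧ ∃ v, ∀ y ∈ S, y i ≠ v := by
        intro a b ha hb hab hxa
        refine ⟨fun y hy hyx => ?_, b, hy' b hb (hxa ▸ hab)⟩
        by_contra hne
        exact ha y ⟨hy, hne⟩ (hyx.trans hxa)
      by_cases hxa : x i = a
      · exact main a b ha hb hab hxa
      · by_cases hxb : x i = b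
        · exact main b a hb ha hab.symm hxb
        · exact absurd (hB i a b (hy' a ha hxa) (hy' b hb hxb)) hab
  · rintro ⟨h1, h2⟩
    exact minBase_construct n hn m (fun i => h1 i (Finset.mem_univ i)) h2
end

section
/- For every integer n > 3, there exists a finite group G acting faithfully and transitively on a finite set Ω such that M(G,Ω) = {3, n}. In particular, M(G,Ω) need not be an interval for transitive groups. (Such a G is given by the wreath product S_n wr C_3 acting on the right cosets of the subgroup S_n × (S_n)_n × 1 of its base group, where (S_n)_n is the stabilizer of the point n in the natural action of S_n.) -/
/-- The set of cosets, with explicit coordinates. -/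
abbrev Om (n : ℕ) : Type := ZMod 3 × Fin n × Equiv.Perm (Fin n)

/-- The permutation of `Om n` given by an element of the wreath product. -/
def wrPerm (n : ℕ) (k : ZMod 3) (p : ZMod 3 → Equiv.Perm (Fin n)) : Equiv.Perm (Om n) where
  toFun x := (x.1 + k, p (x.1 + 1) x.2.1, p (x.1 + 2) * x.2.2)
  invFun x := (x.1 - k, (p (x.1 - k + 1))⁻¹ x.2.1, (p (x.1 - k + 2))⁻¹ * x.2.2)
  left_inv x := by simp
  right_inv x := by simp

theorem wrPerm_apply (n : ℕ) (k : ZMod 3) (p : ZMod 3 → Equiv.Perm (Fin n)) (x : Om n) :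
    wrPerm n k p x = (x.1 + k, p (x.1 + 1) x.2.1, p (x.1 + 2) * x.2.2) := rfl

/-- The wreath product as a permutation group. -/
def wrGroup (n : ℕ) : Subgroup (Equiv.Perm (Om n)) where
  carrier := {g | ∃ k p, g = wrPerm n k p}
  one_mem' := ⟨0, 1, by ext1 x; simp [wrPerm_apply]⟩
  mul_mem' := by
    rintro _ _ ⟨l, q, rfl⟩ ⟨k, p, rfl⟩
    refine ⟨k + l, fun j => q (j + k) * p j, ?_⟩
    ext1 x
    simp only [Equiv.Perm.mul_apply, wrPerm_apply, mul_assoc, add_assoc, add_comm k]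
  inv_mem' := by
    rintro _ ⟨k, p, rfl⟩
    refine ⟨-k, fun j => (p (j - k))⁻¹, ?_⟩
    rw [inv_eq_iff_mul_eq_one]
    ext1 x
    have h1 : x.1 + 1 - k = x.1 - k + 1 := by ring
    have h2 : x.1 + 2 - k = x.1 - k + 2 := by ring
    simp [Equiv.Perm.mul_apply, wrPerm_apply, h1, h2, ← sub_eq_add_neg]

theorem wr_transitive (n : ℕ) : MulAction.IsPretransitive (wrGroup n) (Om n) := by
  constructor
  rintro ⟨i, a, s⟩ ⟨j, b, t⟩
  refine ⟨⟨wrPerm n (j - i) (fun l => if l = i + 1 then Equiv.swap a b else t * s⁻¹), _, _, rfl⟩, ?_⟩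
  have h : (2 : ZMod 3) ≠ 1 := by decide
  simp [Subgroup.smul_def, wrPerm_apply, h]

/-- `S` meets block `i`. -/
def Meets {n : ℕ} (S : Set (Om n)) (i : ZMod 3) : Prop := ∃ a s, (i, a, s) ∈ S

/-- The points of `S` in block `i` miss at most one point of `Fin n`. -/
def Covers {n : ℕ} (S : Set (Om n)) (i : ZMod 3) : Prop :=
  ∀ b c, (∀ s, (i, b, s) ∉ S) → (∀ s, (i, c, s) ∉ S) → b = c

theorem wrPerm_eq_one {n : ℕ} (hn : 3 < n) (k : ZMod 3) (p : ZMod 3 → Equiv.Perm (Fin n))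
    (h : wrPerm n k p = 1) : k = 0 ∧ p = 1 := by
  constructor
  · have := congrArg (fun g => (g (0, ⟨0, by omega⟩, 1)).1) h
    simpa [wrPerm_apply] using this
  · funext j
    have := congrArg (fun g => (g (j - 2, ⟨0, by omega⟩, 1)).2.2) h
    simpa [wrPerm_apply] using this

theorem Covers.meets {n : ℕ} (hn : 3 < n) {S : Set (Om n)} {i : ZMod 3} (h : Covers S i) :
    Meets S i := by
  by_contra hm
  simp only [Meets, not_exists] at hm
  have := h ⟨0, by omega⟩ ⟨1, by omega⟩ (hm _) (hm _)
  simp at this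

theorem isBase_iff {n : ℕ} (hn : 3 < n) (S : Set (Om n)) :
    IsBase (wrGroup n) S ↔ ∀ i, Meets S i ∨ Covers S (i + 1) := by
  constructor
  · intro hb i
    by_contra! hc
    obtain ⟨hm, hc⟩ := hc
    simp only [Covers, not_forall] at hc
    obtain ⟨b, c, hb', hc', hbc⟩ := hc
    have := hb ⟨wrPerm n 0 (fun l => if l = i + 2 then Equiv.swap b c else 1), _, _, rfl⟩ (by
      rintro ⟨j, a, s⟩ hx
      have hij : j ≠ i := by
        rintro rfl
        exact hm ⟨a, s, hx⟩
      simp only [Subgroup.smul_def, wrPerm_apply, Equiv.Perm.smul_def]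
      have h1 : j + 2 ≠ i + 2 := fun h => hij (add_right_cancel h)
      by_cases h2 : j + 1 = i + 2
      · obtain rfl : j = i + 1 := by linear_combination h2
        have hab : a ≠ b := by rintro rfl; exact hb' _ hx
        have hac : a ≠ c := by rintro rfl; exact hc' _ hx
        simp [h1, h2, Equiv.swap_apply_of_ne_of_ne hab hac]
      · simp [h1, h2])
    have := (wrPerm_eq_one hn 0 (fun l => if l = i + 2 then Equiv.swap b c else 1)
      (congrArg Subtype.val this)).2
    have := congrFun this (i + 2)
    simp at this
    exact hbc this
  · rintro h ⟨_, k, p, rfl⟩ hfix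
    have hf : ∀ i a s, (i, a, s) ∈ S → k = 0 ∧ p (i + 1) a = a ∧ p (i + 2) = 1 := by
      intro i a s hx
      have := hfix _ hx
      simpa [Subgroup.smul_def, wrPerm_apply] using this
    have hk : k = 0 := by
      rcases h 0 with ⟨a, s, hx⟩ | hc
      · exact (hf _ _ _ hx).1
      · obtain ⟨a, s, hx⟩ := hc.meets hn
        exact (hf _ _ _ hx).1
    have hp : p = 1 := by
      funext j
      rcases h (j - 2) with ⟨a, s, hx⟩ | hc
      · simpa using (hf _ _ _ hx).2.2
      · have e : j - 2 + 1 + 1 = j := by ring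
        have hfa : ∀ b, p j b ≠ b → ∀ s, (j - 2 + 1, b, s) ∉ S := by
          intro b hb s hx
          have := (hf _ _ _ hx).2.1
          rw [e] at this
          exact hb this
        ext1 b
        by_contra hb
        have hb : p j b ≠ b := hb
        have hb2 : p j (p j b) ≠ p j b := fun h => hb ((p j).injective h)
        exact hb (hc _ _ (hfa _ hb2) (hfa _ hb))
    subst hk hp
    apply Subtype.ext
    ext1 x
    simp [wrPerm_apply]

theorem IsMinBase.eq_of_subset {G : Type*} [Group G] {Ω : Type*} [MulAction G Ω] {S T : Set Ω}
    (h : IsMinBase G S) (hT : T ⊆ S) (hb : IsBase G T) : T = S := by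
  by_contra hne
  exact h.2 T (hT.ssubset_of_ne hne) hb

theorem sizes_subset {n : ℕ} (hn : 3 < n) (S : Set (Om n)) (hS : IsMinBase (wrGroup n) S) :
    S.ncard = 3 ∨ S.ncard = n := by
  by_cases hall : ∀ i, Meets S i
  · left
    choose a s hx using hall
    have hT : Set.range (fun i => ((i, a i, s i) : Om n)) = S := by
      apply hS.eq_of_subset
      · rintro _ ⟨i, rfl⟩
        exact hx i
      · rw [isBase_iff hn]
        exact fun i => Or.inl ⟨a i, s i, i, rfl⟩
    rw [← hT, ← Set.image_univ, Set.ncard_image_of_injective _ (fun i j h => (Prod.ext_iff.1 h).1),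
      Set.ncard_univ, Nat.card_eq_fintype_card, ZMod.card]
  · right
    push Not at hall
    obtain ⟨i, hi⟩ := hall
    have hb := (isBase_iff hn S).1 hS.1
    have hc := (hb i).resolve_left hi
    have hm : Meets S (i + 2) := by
      refine (hb (i + 2)).resolve_right fun h => hi ?_
      have e : i + 2 + 1 = i := by rw [add_assoc, show (2 + 1 : ZMod 3) = 0 by decide, add_zero]
      rw [e] at h
      exact h.meets hn
    obtain ⟨a, t, hy⟩ := hm
    obtain ⟨c, hcc⟩ : ∃ c : Fin n, ∀ b, b ≠ c → ∃ s, (i + 1, b, s) ∈ S := by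
      by_cases hex : ∃ c : Fin n, ∀ s, (i + 1, c, s) ∉ S
      · obtain ⟨c, hcm⟩ := hex
        refine ⟨c, fun b hbc => ?_⟩
        by_contra! hbm
        exact hbc (hc _ _ hbm hcm)
      · push Not at hex
        exact ⟨⟨0, by omega⟩, fun b _ => hex b⟩
    have : ∀ b, ∃ s, b ≠ c → (i + 1, b, s) ∈ S := by
      intro b
      by_cases h : b = c
      · exact ⟨1, fun h' => absurd h h'⟩
      · obtain ⟨s, hs⟩ := hcc b h
        exact ⟨s, fun _ => hs⟩
    choose s hs using this
    have h12 : i + 2 ≠ i + 1 := fun h => absurd (add_left_cancel h) (by decide)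
    have hT : insert ((i + 2, a, t) : Om n) ((fun b => (i + 1, b, s b)) '' {c}ᶜ) = S := by
      apply hS.eq_of_subset
      · rintro _ (rfl | ⟨b, hb, rfl⟩)
        · exact hy
        · exact hs b hb
      · rw [isBase_iff hn]
        have hco : ∀ b, b ≠ c → (i + 1, b, s b) ∈
            insert ((i + 2, a, t) : Om n) ((fun b => (i + 1, b, s b)) '' {c}ᶜ) :=
          fun b hb => Or.inr ⟨b, hb, rfl⟩
        have hcov : Covers (insert ((i + 2, a, t) : Om n)
            ((fun b => (i + 1, b, s b)) '' {c}ᶜ)) (i + 1) := by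
          have : ∀ b, (∀ s', (i + 1, b, s') ∉ insert ((i + 2, a, t) : Om n)
            ((fun b => (i + 1, b, s b)) '' {c}ᶜ)) → b = c := by
            intro b hb
            by_contra hbc
            exact hb _ (hco b hbc)
          intro b b' h h'
          rw [this b h, this b' h']
        intro j
        have hj : j = i ∨ j = i + 1 ∨ j = i + 2 := by
          have : ∀ i j : ZMod 3, j = i ∨ j = i + 1 ∨ j = i + 2 := by decide
          exact this i j
        rcases hj with rfl | rfl | rfl
        · exact Or.inr hcov
        · exact Or.inl (hcov.meets hn)
        · exact Or.inl ⟨a, t, Or.inl rfl⟩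
    rw [← hT, Set.ncard_insert_of_notMem, Set.ncard_image_of_injective,
      Set.ncard_compl, Set.ncard_singleton, Nat.card_eq_fintype_card, Fintype.card_fin]
    · omega
    · intro b b' h
      simpa using congrArg (fun x => x.2.1) h
    · rintro ⟨b, _, h⟩
      exact h12 (congrArg Prod.fst h).symm

theorem three_mem {n : ℕ} (hn : 3 < n) : 3 ∈ MinBaseSizes (wrGroup n) (Om n) := by
  refine ⟨Set.range (fun i => ((i, ⟨0, by omega⟩, 1) : Om n)), ⟨?_, ?_⟩, ?_⟩
  · rw [isBase_iff hn]
    exact fun i => Or.inl ⟨_, _, i, rfl⟩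
  · intro T hT hb
    rw [isBase_iff hn] at hb
    obtain ⟨_, ⟨i, rfl⟩, hi⟩ := Set.exists_of_ssubset hT
    rcases hb i with ⟨a, s, hx⟩ | hc
    · obtain ⟨j, hj⟩ := hT.1 hx
      obtain rfl : j = i := congrArg Prod.fst hj
      exact hi (by simpa only [hj] using hx)
    · have hmiss : ∀ b : Fin n, b.1 ≠ 0 → ∀ s, (i + 1, b, s) ∉ T := by
        intro b hb s hx
        obtain ⟨j, hj⟩ := hT.1 hx
        have : (⟨0, by omega⟩ : Fin n) = b := congrArg (fun x => x.2.1) hj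
        exact hb (by rw [← this])
      have := hc ⟨1, by omega⟩ ⟨2, by omega⟩ (hmiss _ (by simp)) (hmiss _ (by simp))
      simp at this
  · rw [← Set.image_univ, Set.ncard_image_of_injective _ (fun i j h => (Prod.ext_iff.1 h).1),
      Set.ncard_univ, Nat.card_eq_fintype_card, ZMod.card]

theorem n_mem {n : ℕ} (hn : 3 < n) : n ∈ MinBaseSizes (wrGroup n) (Om n) := by
  set c : Fin n := ⟨0, by omega⟩
  have h21 : (2 : ZMod 3) ≠ 1 := by decide
  have h20 : (2 : ZMod 3) ≠ 0 := by decide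
  have h10 : (1 : ZMod 3) ≠ 0 := by decide
  have hall : ∀ j : ZMod 3, j = 0 ∨ j = 1 ∨ j = 2 := by decide
  have hm : ∀ j b s, ((j, b, s) : Om n) ∈
      insert ((2, c, 1) : Om n) ((fun b => (1, b, 1)) '' {c}ᶜ) ↔
      (j = 2 ∧ b = c ∧ s = 1) ∨ (j = 1 ∧ b ≠ c ∧ s = 1) := by
    intro j b s
    simp only [Set.mem_insert_iff, Prod.mk.injEq, Set.mem_image, Set.mem_compl_iff,
      Set.mem_singleton_iff]
    constructor
    · rintro (h | ⟨b', h, rfl, rfl, rfl⟩)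
      · exact Or.inl h
      · exact Or.inr ⟨rfl, h, rfl⟩
    · rintro (h | ⟨rfl, h, rfl⟩)
      · exact Or.inl h
      · exact Or.inr ⟨b, h, rfl, rfl, rfl⟩
  refine ⟨insert ((2, c, 1) : Om n) ((fun b => (1, b, 1)) '' {c}ᶜ), ⟨?_, ?_⟩, ?_⟩
  · rw [isBase_iff hn]
    have hcov : Covers (insert ((2, c, 1) : Om n) ((fun b => (1, b, 1)) '' {c}ᶜ)) 1 := by
      have : ∀ b, (∀ s, ((1, b, s) : Om n) ∉
          insert ((2, c, 1) : Om n) ((fun b => (1, b, 1)) '' {c}ᶜ)) → b = c := by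
        intro b hb
        by_contra hbc
        exact hb 1 ((hm _ _ _).2 (Or.inr ⟨rfl, hbc, rfl⟩))
      intro b b' h h'
      rw [this b h, this b' h']
    intro j
    rcases hall j with rfl | rfl | rfl
    · exact Or.inr (by simpa using hcov)
    · exact Or.inl (hcov.meets hn)
    · exact Or.inl ⟨c, 1, Or.inl rfl⟩
  · intro T hT hb
    rw [isBase_iff hn] at hb
    have h0 : ¬ Meets T 0 := by
      rintro ⟨b, s, hx⟩
      rcases (hm _ _ _).1 (hT.1 hx) with h | h
      · exact h20 h.1.symm
      · exact h10 h.1.symm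
    obtain ⟨⟨j, b, s⟩, hx, hxT⟩ := Set.exists_of_ssubset hT
    rcases (hm _ _ _).1 hx with ⟨rfl, rfl, rfl⟩ | ⟨rfl, hbc, rfl⟩
    · rcases hb 2 with ⟨b', s', hx'⟩ | h
      · rcases (hm _ _ _).1 (hT.1 hx') with ⟨_, rfl, rfl⟩ | h
        · exact hxT hx'
        · exact h21 h.1
      · rw [show (2 + 1 : ZMod 3) = 0 by decide] at h
        exact h0 (h.meets hn)
    · have h := (hb 0).resolve_left h0
      rw [zero_add] at h
      refine hbc (h b c ?_ ?_)
      · intro s hx'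
        rcases (hm _ _ _).1 (hT.1 hx') with h | ⟨_, _, rfl⟩
        · exact h21 h.1.symm
        · exact hxT hx'
      · intro s hx'
        rcases (hm _ _ _).1 (hT.1 hx') with h | ⟨_, h, _⟩
        · exact h21 h.1.symm
        · exact h rfl
  · rw [Set.ncard_insert_of_notMem, Set.ncard_image_of_injective,
      Set.ncard_compl, Set.ncard_singleton, Nat.card_eq_fintype_card, Fintype.card_fin]
    · omega
    · intro b b' h
      simpa using congrArg (fun x => x.2.1) h
    · rintro ⟨b, _, h⟩
      exact h21 (congrArg Prod.fst h).symm

/-- **Proposition 4.1.** For every `n > 3` there is a finite group acting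
faithfully and transitively on a finite set (here: a transitive subgroup `G` of
the symmetric group on a finite set `Ω`) whose set of cardinalities of minimal
bases is exactly `{3, n}`; in particular `𝓜(G,Ω)` need not be an interval for
transitive groups. -/
theorem exists_transitive_minBaseSizes_eq_three_n (n : ℕ) (hn : 3 < n) :
    ∃ (Ω : Type) (_ : Finite Ω) (G : Subgroup (Equiv.Perm Ω)),
      MulAction.IsPretransitive G Ω ∧ MinBaseSizes G Ω = {3, n} := by
  refine ⟨Om n, inferInstance, wrGroup n, wr_transitive n, ?_⟩
  ext m
  simp only [Set.mem_insert_iff, Set.mem_singleton_iff]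
  constructor
  · rintro ⟨S, hS, rfl⟩
    exact sizes_subset hn S hS
  · rintro (rfl | rfl)
    · exact three_mem hn
    · exact n_mem hn
end

section
/- For every integer n > 3, there exists a finite group G acting faithfully and transitively on a finite set Ω such that M(G,Ω) = {2, n}. (Such a G is given by the wreath product S_n wr C_2 acting on the right cosets of the subgroup (S_n)_n × 1 of its base group, where (S_n)_n is the stabilizer of the point n in the natural action of S_n.) -/
namespace TwoN

abbrev Pt (m : ℕ) : Type := Bool × Fin m × Equiv.Perm (Fin m)

/-- The permutation of `Pt m` given by an element of the wreath product. -/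
def act {m : ℕ} (s : Bool) (a : Bool → Equiv.Perm (Fin m)) : Equiv.Perm (Pt m) where
  toFun x := (xor x.1 s, a x.1 x.2.1, a (!x.1) * x.2.2)
  invFun x := (xor x.1 s, (a (xor x.1 s))⁻¹ x.2.1, (a (!(xor x.1 s)))⁻¹ * x.2.2)
  left_inv x := by
    obtain ⟨c, i, t⟩ := x
    cases c <;> cases s <;> simp
  right_inv x := by
    obtain ⟨c, i, t⟩ := x
    cases c <;> cases s <;> simp

/-- The wreath product as a permutation group. -/
def W (m : ℕ) : Subgroup (Equiv.Perm (Pt m)) where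
  carrier := {g | ∃ s a, g = act s a}
  one_mem' := ⟨false, fun _ => 1, by ext x <;> simp [act]⟩
  mul_mem' := by
    rintro _ _ ⟨s, a, rfl⟩ ⟨s', a', rfl⟩
    refine ⟨xor s' s, fun c => a (xor c s') * a' c, ?_⟩
    apply Equiv.ext
    rintro ⟨c, i, t⟩
    simp [act, mul_assoc]
  inv_mem' := by
    rintro _ ⟨s, a, rfl⟩
    refine ⟨s, fun c => (a (xor c s))⁻¹, ?_⟩
    apply Equiv.ext
    rintro ⟨c, i, t⟩
    rw [Equiv.Perm.inv_def, Equiv.symm_apply_eq]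
    cases c <;> cases s <;> simp [act]

lemma trans (m : ℕ) : MulAction.IsPretransitive (W m) (Pt m) := by
  constructor
  rintro ⟨c, i, t⟩ ⟨d, j, u⟩
  refine ⟨⟨act (xor c d) (fun b => if b = c then Equiv.swap i j else u * t⁻¹), _, _, rfl⟩, ?_⟩
  rw [Subgroup.smul_def, Equiv.Perm.smul_def]
  simp [act]

lemma isBase_iff {m : ℕ} (hm : 2 ≤ m) (S : Set (Pt m)) :
    IsBase (W m) S ↔ (∃ x ∈ S, ∃ y ∈ S, x.1 ≠ y.1) ∨
      (∀ i j, (∀ x ∈ S, x.2.1 ≠ i) → (∀ x ∈ S, x.2.1 ≠ j) → i = j) := by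
  constructor
  · intro h
    by_contra! hc
    obtain ⟨h1, i, j, hi, hj, hij⟩ := hc
    obtain ⟨c, hS⟩ : ∃ c, ∀ x ∈ S, x.1 = c := by
      rcases S.eq_empty_or_nonempty with rfl | ⟨y, hy⟩
      · exact ⟨true, by simp⟩
      · exact ⟨y.1, fun x hx => h1 x hx y hy⟩
    have := h ⟨act false (fun b => if b = c then Equiv.swap i j else 1), _, _, rfl⟩ (by
      rintro ⟨d, k, t⟩ hx
      obtain rfl : d = c := hS _ hx
      rw [Subgroup.smul_def, Equiv.Perm.smul_def]
      have h2 := hi _ hx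
      have h3 := hj _ hx
      simp [act, Equiv.swap_apply_of_ne_of_ne h2 h3])
    have h4 := congrArg (fun g : W m => (g : Equiv.Perm (Pt m)) (c, i, 1)) this
    simp [act] at h4
    exact hij h4.symm
  · rintro h ⟨_, s, a, rfl⟩ hg
    have hg' : ∀ x ∈ S, s = false ∧ a x.1 x.2.1 = x.2.1 ∧ a (!x.1) = 1 := by
      intro x hx
      have h1 : act s a x = x := hg x hx
      obtain ⟨c, i, t⟩ := x
      cases c <;> cases s <;> simpa [act] using h1
    have key : s = false ∧ ∀ c, a c = 1 := by
      rcases h with ⟨x, hx, y, hy, hxy⟩ | h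
      · refine ⟨(hg' x hx).1, fun c => ?_⟩
        have h1 := (hg' x hx).2.2
        have h2 := (hg' y hy).2.2
        clear hg hg'
        revert h1 h2 hxy
        generalize x.1 = p
        generalize y.1 = q
        cases p <;> cases q <;> cases c <;> simp +contextual
      · obtain ⟨x, hx⟩ : S.Nonempty := by
          by_contra hne
          rw [Set.not_nonempty_iff_eq_empty] at hne
          have := h ⟨0, by omega⟩ ⟨1, by omega⟩ (by simp [hne]) (by simp [hne])
          simp at this
        refine ⟨(hg' x hx).1, fun c => ?_⟩
        by_cases hc : c = !x.1
        · rw [hc]; exact (hg' x hx).2.2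
        have hfix : ∀ y ∈ S, a c y.2.1 = y.2.1 := by
          intro y hy
          by_cases hcy : c = y.1
          · rw [hcy]; exact (hg' y hy).2.1
          · have : c = !y.1 := by
              revert hcy
              generalize y.1 = q
              cases c <;> cases q <;> simp
            rw [this, (hg' y hy).2.2]; rfl
        ext i
        rw [Equiv.Perm.one_apply]
        congr 1
        by_contra hne
        have hi : ∀ y ∈ S, y.2.1 ≠ i := by
          rintro y hy rfl
          exact hne (hfix y hy)
        refine hne (h _ _ ?_ hi)
        intro y hy he
        have := hfix y hy
        rw [he] at this
        exact hne ((a c).injective this)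
    apply Subtype.ext
    apply Equiv.ext
    rintro ⟨c, i, t⟩
    simp [act, key.1, key.2]

end TwoN

/-- **Proposition 4.2.** For every `n > 3` there is a finite group acting
faithfully and transitively on a finite set (here: a transitive subgroup `G` of
the symmetric group on a finite set `Ω`) whose set of cardinalities of minimal
bases is exactly `{2, n}`. -/
theorem exists_transitive_minBaseSizes_eq_two_n (n : ℕ) (hn : 3 < n) :
    ∃ (Ω : Type) (_ : Finite Ω) (G : Subgroup (Equiv.Perm Ω)),
      MulAction.IsPretransitive G Ω ∧ MinBaseSizes G Ω = {2, n} := by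
  classical
  refine ⟨TwoN.Pt (n + 1), inferInstance, TwoN.W (n + 1), TwoN.trans _, ?_⟩
  have hb := TwoN.isBase_iff (m := n + 1) (by omega)
  ext k
  simp only [MinBaseSizes, Set.mem_setOf_eq, Set.mem_insert_iff, Set.mem_singleton_iff]
  constructor
  · rintro ⟨S, ⟨hS, hmin⟩, rfl⟩
    by_cases h : ∃ x ∈ S, ∃ y ∈ S, x.1 ≠ y.1
    · left
      obtain ⟨x, hx, y, hy, hxy⟩ := h
      have hsub : ({x, y} : Set _) ⊆ S := by
        rintro z (rfl | rfl) <;> assumption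
      have hbase := (hb {x, y}).2 (Or.inl ⟨x, by simp, y, by simp, hxy⟩)
      have : ({x, y} : Set _) = S := by
        by_contra hne
        exact hmin _ (lt_of_le_of_ne hsub hne) hbase
      rw [← this]
      exact Set.ncard_pair (fun h => hxy (by rw [h]))
    · right
      have hu := ((hb S).1 hS).resolve_left h
      have hrem : ∀ x ∈ S, ∃ i j, (∀ y ∈ S, y ≠ x → y.2.1 ≠ i) ∧
          (∀ y ∈ S, y ≠ x → y.2.1 ≠ j) ∧ i ≠ j := by
        intro x hx
        have h1 := hmin (S \ {x}) (Set.diff_singleton_ssubset.2 hx)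
        rw [hb] at h1
        push Not at h1
        obtain ⟨-, i, j, hi, hj, hij⟩ := h1
        exact ⟨i, j, fun y hy hyx => hi y ⟨hy, hyx⟩, fun y hy hyx => hj y ⟨hy, hyx⟩, hij⟩
      have hinj : Set.InjOn (fun x : TwoN.Pt (n + 1) => x.2.1) S := by
        intro x hx y hy hxy
        by_contra hne
        obtain ⟨i, j, hi, hj, hij⟩ := hrem x hx
        have aux : ∀ i, (∀ y ∈ S, y ≠ x → y.2.1 ≠ i) → ∀ y ∈ S, y.2.1 ≠ i := by
          intro i hi z hz
          by_cases hzx : z = x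
          · rw [hzx]
            intro h'
            exact hi y hy (Ne.symm hne) (hxy.symm.trans h')
          · exact hi z hz hzx
        exact hij (hu i j (aux i hi) (aux j hj))
      have hmiss : ∃ i, ∀ x ∈ S, x.2.1 ≠ i := by
        by_contra! hall
        obtain ⟨x, hx, -⟩ := hall 0
        obtain ⟨i, j, hi, hj, hij⟩ := hrem x hx
        have aux : ∀ i, (∀ y ∈ S, y ≠ x → y.2.1 ≠ i) → x.2.1 = i := by
          intro i hi
          obtain ⟨z, hz, hzi⟩ := hall i
          by_cases hzx : z = x
          · rw [← hzx]; exact hzi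
          · exact absurd hzi (hi z hz hzx)
        exact hij ((aux i hi).symm.trans (aux j hj))
      obtain ⟨i, hi⟩ := hmiss
      have himg : (fun x : TwoN.Pt (n + 1) => x.2.1) '' S = {i}ᶜ := by
        ext j
        simp only [Set.mem_image, Set.mem_compl_iff, Set.mem_singleton_iff]
        constructor
        · rintro ⟨x, hx, rfl⟩
          exact hi x hx
        · intro hji
          by_contra! hc
          exact hji (hu j i hc hi)
      rw [← Set.ncard_image_of_injOn hinj, himg, Set.ncard_compl]
      simp
  · rintro (rfl | rfl)
    · refine ⟨{(true, 0, 1), (false, 0, 1)}, ⟨?_, ?_⟩, ?_⟩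
      · rw [hb]
        exact Or.inl ⟨_, Or.inl rfl, _, Or.inr rfl, by simp⟩
      · intro T hT
        rw [hb]
        push Not
        have h0 : ∀ x ∈ T, x.2.1 = 0 := by
          intro x hx
          rcases hT.1 hx with rfl | rfl <;> rfl
        refine ⟨?_, ⟨1, by omega⟩, ⟨2, by omega⟩, ?_, ?_, by simp⟩
        · intro x hx y hy
          by_contra hxy
          apply hT.2
          rcases hT.1 hx with rfl | rfl <;> rcases hT.1 hy with rfl | rfl
          · exact absurd rfl hxy
          · rintro z (rfl | rfl) <;> assumption
          · rintro z (rfl | rfl) <;> assumption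
          · exact absurd rfl hxy
        · intro x hx
          rw [h0 x hx]
          simp [Fin.ext_iff]
        · intro x hx
          rw [h0 x hx]
          simp [Fin.ext_iff]
      · exact Set.ncard_pair (by simp)
    · refine ⟨(fun i : Fin (k + 1) => ((true, i, 1) : TwoN.Pt (k + 1))) '' {0}ᶜ, ⟨?_, ?_⟩, ?_⟩
      · rw [hb]
        right
        have aux : ∀ i : Fin (k + 1), (∀ x ∈ (fun i : Fin (k + 1) =>
            ((true, i, 1) : TwoN.Pt (k + 1))) '' {0}ᶜ, x.2.1 ≠ i) → i = 0 := by
          intro i hi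
          by_contra h0
          exact hi _ ⟨i, h0, rfl⟩ rfl
        intro i j hi hj
        rw [aux i hi, aux j hj]
      · intro T hT
        obtain ⟨x, ⟨i, hi0, rfl⟩, hxT⟩ := Set.exists_of_ssubset hT
        rw [hb]
        push Not
        refine ⟨?_, i, 0, ?_, ?_, hi0⟩
        · intro x hx y hy
          obtain ⟨_, _, rfl⟩ := hT.1 hx
          obtain ⟨_, _, rfl⟩ := hT.1 hy
          rfl
        · intro x hx
          obtain ⟨j, _, rfl⟩ := hT.1 hx
          rintro rfl
          exact hxT hx
        · intro x hx
          obtain ⟨j, hj, rfl⟩ := hT.1 hx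
          exact hj
      · rw [Set.ncard_image_of_injective, Set.ncard_compl]
        · simp
        · intro i j hij
          simpa using hij
end
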